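/- For every integer n > 14, the border rank of the rectangular matrix multiplication tensor satisfies BR(M⟨3,n,n⟩) ≥ n² + 2n. -/

import Mathlib

open scoped BigOperators

noncomputable section

/-- A tensor `T ∈ ℂ^{ι₁} ⊗ ℂ^{ι₂} ⊗ ℂ^{ι₃}`, written in coordinates, has rank at most `r`
if it is a sum of `r` simple tensors. -/
def rankLE {ι₁ ι₂ ι₃ : Type*} (T : ι₁ → ι₂ → ι₃ → ℂ) (r : ℕ) : Prop :=
  ∃ u : Fin r → ι₁ → ℂ, ∃ v : Fin r → ι₂ → ℂ, ∃ w : Fin r → ι₃ → ℂ,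
    T = fun i j k => ∑ l, u l i * v l j * w l k

/-- The rank of a tensor. -/
def trank {ι₁ ι₂ ι₃ : Type*} (T : ι₁ → ι₂ → ι₃ → ℂ) : ℕ :=
  sInf {r | rankLE T r}

/-- The border rank of a tensor: the least `r` such that `T` is a limit of tensors of rank
at most `r` (closure in the Euclidean = product topology). -/
def brank {ι₁ ι₂ ι₃ : Type*} [Fintype ι₁] [Fintype ι₂] [Fintype ι₃]
    (T : ι₁ → ι₂ → ι₃ → ℂ) : ℕ :=
  sInf {r | T ∈ closure {S : ι₁ → ι₂ → ι₃ → ℂ | rankLE S r}}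

/-- The matrix multiplication tensor `M⟨a,b,c⟩ = Σ e_{ij} ⊗ e_{jk} ⊗ e_{ki}`. -/
def matMulTensor (a b c : ℕ) :
    (Fin a × Fin b) → (Fin b × Fin c) → (Fin c × Fin a) → ℂ :=
  fun x y z => if x.2 = y.1 ∧ y.2 = z.1 ∧ z.2 = x.1 then 1 else 0

/-- Kronecker product of tensors. -/
def kron {ι₁ ι₂ ι₃ κ₁ κ₂ κ₃ : Type*} (T : ι₁ → ι₂ → ι₃ → ℂ) (T' : κ₁ → κ₂ → κ₃ → ℂ) :
    (ι₁ × κ₁) → (ι₂ × κ₂) → (ι₃ × κ₃) → ℂ :=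
  fun i j k => T i.1 j.1 k.1 * T' i.2 j.2 k.2

/-- The little Coppersmith–Winograd tensor
`cw_q = Σ_{i=1}^q (e₀⊗eᵢ⊗eᵢ + eᵢ⊗e₀⊗eᵢ + eᵢ⊗eᵢ⊗e₀)`. -/
def cw (q : ℕ) : Fin (q + 1) → Fin (q + 1) → Fin (q + 1) → ℂ :=
  fun i j k =>
    if (i.val = 0 ∧ j = k ∧ j.val ≠ 0) ∨ (j.val = 0 ∧ i = k ∧ i.val ≠ 0) ∨
       (k.val = 0 ∧ i = j ∧ i.val ≠ 0)
    then 1 else 0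

/-- The big Coppersmith–Winograd tensor `CW_{m-2} ∈ ℂ^m ⊗ ℂ^m ⊗ ℂ^m` (for `m ≥ 3`). -/
def bigCW (m : ℕ) : Fin m → Fin m → Fin m → ℂ :=
  fun i j k =>
    if (i.val = 0 ∧ j.val = 0 ∧ k.val = m - 1) ∨
       (i.val = 0 ∧ j.val = m - 1 ∧ k.val = 0) ∨
       (i.val = m - 1 ∧ j.val = 0 ∧ k.val = 0) ∨
       (i.val = 0 ∧ j = k ∧ 1 ≤ j.val ∧ j.val ≤ m - 2) ∨
       (j.val = 0 ∧ i = k ∧ 1 ≤ i.val ∧ i.val ≤ m - 2) ∨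
       (k.val = 0 ∧ i = j ∧ 1 ≤ i.val ∧ i.val ≤ m - 2)
    then 1 else 0

/-- The skew Coppersmith–Winograd tensor `T_{skewcw,2} ∈ ℂ³⊗ℂ³⊗ℂ³`. -/
def skewCW2 : Fin 3 → Fin 3 → Fin 3 → ℂ :=
  fun i j k =>
    if (i = 0 ∧ j = 1 ∧ k = 1) ∨ (i = 0 ∧ j = 2 ∧ k = 2) ∨ (i = 1 ∧ j = 0 ∧ k = 1) ∨
       (i = 2 ∧ j = 0 ∧ k = 2) ∨ (i = 1 ∧ j = 2 ∧ k = 0)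
    then 1
    else if i = 2 ∧ j = 1 ∧ k = 0 then -1 else 0

/-- Action of a triple of linear maps (matrices) on a tensor. -/
def triApply {a b c a' b' c' : ℕ}
    (g₁ : Matrix (Fin a') (Fin a) ℂ) (g₂ : Matrix (Fin b') (Fin b) ℂ)
    (g₃ : Matrix (Fin c') (Fin c) ℂ) (T : Fin a → Fin b → Fin c → ℂ) :
    Fin a' → Fin b' → Fin c' → ℂ :=
  fun i j k => ∑ i', ∑ j', ∑ k', g₁ i i' * g₂ j j' * g₃ k k' * T i' j' k'

/-- The unit (diagonal) tensor `I_r ∈ ℂ^r ⊗ ℂ^r ⊗ ℂ^r`. -/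
def unitTensor (r : ℕ) : Fin r → Fin r → Fin r → ℂ :=
  fun i j k => if i = j ∧ j = k then 1 else 0

/-- The unit tensor `I_r = Σ_{ℓ=1}^r a_ℓ⊗b_ℓ⊗c_ℓ` embedded in `ℂ^a ⊗ ℂ^b ⊗ ℂ^c`
(for `r ≤ min{a,b,c}`). -/
def unitIn (a b c r : ℕ) : Fin a → Fin b → Fin c → ℂ :=
  fun i j k => if i.val = j.val ∧ j.val = k.val ∧ i.val < r then 1 else 0

/-- The subrank `Q(T)`: largest `r` so that linear maps take `T` to the unit tensor `I_r`. -/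
def subrank {a b c : ℕ} (T : Fin a → Fin b → Fin c → ℂ) : ℕ :=
  sSup {r | ∃ f : Matrix (Fin r) (Fin a) ℂ, ∃ g : Matrix (Fin r) (Fin b) ℂ,
    ∃ h : Matrix (Fin r) (Fin c) ℂ, triApply f g h T = unitTensor r}

/-- The `GL(A) × GL(B) × GL(C)`-orbit of a tensor. -/
def glOrbit {a b c : ℕ} (T : Fin a → Fin b → Fin c → ℂ) :
    Set (Fin a → Fin b → Fin c → ℂ) :=
  {S | ∃ g₁ : Matrix (Fin a) (Fin a) ℂ, ∃ g₂ : Matrix (Fin b) (Fin b) ℂ,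
    ∃ g₃ : Matrix (Fin c) (Fin c) ℂ, IsUnit g₁ ∧ IsUnit g₂ ∧ IsUnit g₃ ∧
      S = triApply g₁ g₂ g₃ T}

/-- The border subrank `Q̲(T)`: largest `r` (with `r ≤ min{a,b,c}`) such that `I_r` lies in
the closure of the `GL×GL×GL`-orbit of `T`. -/
def bsubrank {a b c : ℕ} (T : Fin a → Fin b → Fin c → ℂ) : ℕ :=
  sSup {r | r ≤ min a (min b c) ∧ unitIn a b c r ∈ closure (glOrbit T)}

/-- Multilinear rank in the `A`-factor: rank of the contraction `T_A : A* → B⊗C`. -/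
def mlA {a b c : ℕ} (T : Fin a → Fin b → Fin c → ℂ) : ℕ :=
  (Matrix.of fun (i : Fin a) (p : Fin b × Fin c) => T i p.1 p.2).rank

/-- Multilinear rank in the `B`-factor. -/
def mlB {a b c : ℕ} (T : Fin a → Fin b → Fin c → ℂ) : ℕ :=
  (Matrix.of fun (j : Fin b) (p : Fin a × Fin c) => T p.1 j p.2).rank

/-- Multilinear rank in the `C`-factor. -/
def mlC {a b c : ℕ} (T : Fin a → Fin b → Fin c → ℂ) : ℕ :=
  (Matrix.of fun (k : Fin c) (p : Fin a × Fin b) => T p.1 p.2 k).rank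

/-- `T` is `1_A`-generic: some contraction `T(α) : B* → C` has full rank `m`. -/
def oneAGeneric {m : ℕ} (T : Fin m → Fin m → Fin m → ℂ) : Prop :=
  ∃ α : Fin m → ℂ, (Matrix.of fun j k => ∑ i, α i * T i j k).rank = m

def oneBGeneric {m : ℕ} (T : Fin m → Fin m → Fin m → ℂ) : Prop :=
  ∃ β : Fin m → ℂ, (Matrix.of fun i k => ∑ j, β j * T i j k).rank = m

def oneCGeneric {m : ℕ} (T : Fin m → Fin m → Fin m → ℂ) : Prop :=
  ∃ γ : Fin m → ℂ, (Matrix.of fun i j => ∑ k, γ k * T i j k).rank = m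

/-- `T` is `1`-generic. -/
def oneGeneric {m : ℕ} (T : Fin m → Fin m → Fin m → ℂ) : Prop :=
  oneAGeneric T ∧ oneBGeneric T ∧ oneCGeneric T

/-- The symmetry Lie algebra `g̃_T ⊂ gl(A) ⊕ gl(B) ⊕ gl(C)` of a tensor, as a set. -/
def symLieSet {m : ℕ} (T : Fin m → Fin m → Fin m → ℂ) :
    Set (Matrix (Fin m) (Fin m) ℂ × Matrix (Fin m) (Fin m) ℂ × Matrix (Fin m) (Fin m) ℂ) :=
  {XYZ | ∀ i j k, (∑ i', XYZ.1 i i' * T i' j k) + (∑ j', XYZ.2.1 j j' * T i j' k) +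
    (∑ k', XYZ.2.2 k k' * T i j k') = 0}


section SecM1
open Module

abbrev M3 := Fin 3 → Fin 3 → ℂ
abbrev T3 := Fin 3 → Fin 3 → Fin 3 → ℂ

def idM : M3 := fun a k => if a = k then 1 else 0

/-- tensors all of whose slices lie in `E`, resp. `F`. -/
def WW (E F : Submodule ℂ M3) : Submodule ℂ T3 where
  carrier := {θ | (∀ b, (fun a k => θ a b k) ∈ E) ∧ ∀ a, (fun b k => θ a b k) ∈ F}
  zero_mem' := ⟨fun _ => E.zero_mem, fun _ => F.zero_mem⟩
  add_mem' := fun h1 h2 => ⟨fun b => E.add_mem (h1.1 b) (h2.1 b), fun a => F.add_mem (h1.2 a) (h2.2 a)⟩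
  smul_mem' := fun c _ h => ⟨fun b => E.smul_mem c (h.1 b), fun a => F.smul_mem c (h.2 a)⟩

/-- symmetric tensors all of whose slices lie in `E`. -/
def SS (E : Submodule ℂ M3) : Submodule ℂ T3 where
  carrier := {θ | (∀ a b k, θ a b k = θ b a k) ∧ ∀ b, (fun a k => θ a b k) ∈ E}
  zero_mem' := ⟨fun _ _ _ => rfl, fun _ => E.zero_mem⟩
  add_mem' := fun h1 h2 => ⟨fun a b k => by
      simp only [Pi.add_apply]; rw [h1.1 a b k, h2.1 a b k], fun b => E.add_mem (h1.2 b) (h2.2 b)⟩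
  smul_mem' := fun c _ h => ⟨fun a b k => by
      simp only [Pi.smul_apply]; rw [h.1 a b k], fun b => E.smul_mem c (h.2 b)⟩

/-- the vectors `v` with `v ⊗ V* ⊆ E`. -/
def Av (E : Submodule ℂ M3) : Submodule ℂ (Fin 3 → ℂ) where
  carrier := {v | ∀ ξ : Fin 3 → ℂ, (fun a k => v a * ξ k) ∈ E}
  zero_mem' := fun ξ => by
    convert E.zero_mem using 1; funext a k; simp
  add_mem' := fun {v w} h1 h2 ξ => by
    convert E.add_mem (h1 ξ) (h2 ξ) using 1; funext a k; simp [add_mul]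
  smul_mem' := fun c v h ξ => by
    convert E.smul_mem c (h ξ) using 1; funext a k; simp [mul_assoc]

def trL : M3 ≃ₗ[ℂ] M3 where
  toFun X := fun a k => X k a
  invFun X := fun a k => X k a
  map_add' _ _ := rfl
  map_smul' _ _ := rfl
  left_inv _ := rfl
  right_inv _ := rfl

/-- transposed space -/
def trE (E : Submodule ℂ M3) : Submodule ℂ M3 := E.map trL.toLinearMap

lemma mem_trE {E : Submodule ℂ M3} {X : M3} : X ∈ trE E ↔ (fun a k => X k a) ∈ E := by
  constructor
  · rintro ⟨Y, hY, rfl⟩; exact hY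
  · intro h; exact ⟨_, h, rfl⟩

lemma finrank_trE (E : Submodule ℂ M3) : finrank ℂ (trE E) = finrank ℂ E :=
  LinearEquiv.finrank_map_eq trL E

lemma idM_mem_trE {E : Submodule ℂ M3} (h : idM ∈ E) : idM ∈ trE E := by
  rw [mem_trE]; convert h using 1; funext a k; simp [idM, eq_comm]

lemma trE_trE (E : Submodule ℂ M3) : trE (trE E) = E := by
  ext X; rw [mem_trE, mem_trE]

lemma idM_ne : idM ≠ 0 := by
  intro h; have := congrFun (congrFun h 0) 0; simp [idM] at this

lemma finrank_pos_of_id {E : Submodule ℂ M3} (h : idM ∈ E) : 1 ≤ finrank ℂ E := by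
  have : Nontrivial E := ⟨⟨⟨idM, h⟩, 0, fun h' => idM_ne (congrArg Subtype.val h')⟩⟩
  exact finrank_pos

lemma finrank_M3_le (E : Submodule ℂ M3) : finrank ℂ E ≤ 9 := by
  have := Submodule.finrank_le E
  have h9 : finrank ℂ M3 = 9 := by
    rw [Module.finrank_pi_fintype]; simp
  omega

def piM : M3 →ₗ[ℂ] M3 where
  toFun X := fun a k => X a k - X 0 0 * idM a k
  map_add' X Y := by funext a k; simp; ring
  map_smul' c X := by funext a k; simp; ring

lemma finrank_map_piM {E : Submodule ℂ M3} (h : idM ∈ E) :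
    finrank ℂ (E.map piM) + 1 ≤ finrank ℂ E := by
  have h1 := LinearMap.finrank_range_add_finrank_ker (piM.domRestrict E)
  have h2 : LinearMap.range (piM.domRestrict E) = E.map piM := by
    rw [LinearMap.range_domRestrict]
  rw [h2] at h1
  have h3 : 1 ≤ finrank ℂ (LinearMap.ker (piM.domRestrict E)) := by
    have : Nontrivial (LinearMap.ker (piM.domRestrict E)) := by
      refine ⟨⟨⟨⟨idM, h⟩, ?_⟩, 0, ?_⟩⟩
      · rw [LinearMap.mem_ker]; funext a k; simp [piM, idM]
      · intro h'; exact idM_ne (congrArg (fun x => (x : E).1) (congrArg Subtype.val h'))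
    exact Nat.succ_le_of_lt (Module.finrank_pos (R := ℂ) (M := LinearMap.ker (piM.domRestrict E)))
  omega

lemma finrank_WW_le (E F : Submodule ℂ M3) (hE : idM ∈ E) :
    finrank ℂ (WW E F) + 3 ≤ 3 * finrank ℂ E + finrank ℂ (Av F) := by
  let Ψ : WW E F →ₗ[ℂ] (Fin 3 → E.map piM) :=
    { toFun := fun θ b => ⟨piM (fun a k => θ.1 a b k), ⟨_, θ.2.1 b, rfl⟩⟩
      map_add' := fun θ θ' => by
        funext b; apply Subtype.ext; exact piM.map_add _ _
      map_smul' := fun c θ => by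
        funext b; apply Subtype.ext; exact piM.map_smul _ _ }
  have key : ∀ θ : WW E F, Ψ θ = 0 → ∀ a b k, θ.1 a b k = θ.1 0 b 0 * idM a k := by
    intro θ h a b k
    have := congrFun (congrFun (congrArg Subtype.val (congrFun h b)) a) k
    simp only [Ψ, piM, LinearMap.coe_mk, AddHom.coe_mk] at this
    exact sub_eq_zero.mp this
  let κ : LinearMap.ker Ψ →ₗ[ℂ] Av F :=
    { toFun := fun θ => ⟨fun b => θ.1.1 0 b 0, by
        intro ξ
        have h := key θ.1 θ.2
        have h2 : (fun b k => ∑ a, ξ a * θ.1.1 a b k) ∈ F := by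
          have := F.sum_mem (t := Finset.univ) (f := fun a => ξ a • (fun b k => θ.1.1 a b k))
            (fun a _ => F.smul_mem _ (θ.1.2.2 a))
          convert this using 1
          funext b k; simp [Finset.sum_apply]
        convert h2 using 1
        funext b k
        have : ∀ a, θ.1.1 a b k = θ.1.1 0 b 0 * idM a k := fun a => h a b k
        rw [Finset.sum_congr rfl (fun a _ => by rw [this a])]
        simp [idM, mul_comm]⟩
      map_add' := fun _ _ => rfl
      map_smul' := fun _ _ => rfl }
  have hκ : Function.Injective κ := by
    intro θ θ' h
    apply Subtype.ext; apply Subtype.ext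
    funext a b k
    have h0 : θ.1.1 0 b 0 = θ'.1.1 0 b 0 := congrFun (congrArg Subtype.val h) b
    rw [key θ.1 θ.2 a b k, key θ'.1 θ'.2 a b k, h0]
  have h1 := LinearMap.finrank_le_finrank_of_injective hκ
  have h2 := LinearMap.finrank_range_add_finrank_ker Ψ
  have h3 := Submodule.finrank_le (LinearMap.range Ψ)
  have h4 := finrank_map_piM hE
  rw [Module.finrank_pi_fintype] at h3
  simp only [Finset.sum_const, Finset.card_univ, Fintype.card_fin, smul_eq_mul] at h3
  omega

def swapT : T3 ≃ₗ[ℂ] T3 where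
  toFun θ := fun a b k => θ b a k
  invFun θ := fun a b k => θ b a k
  map_add' _ _ := rfl
  map_smul' _ _ := rfl
  left_inv _ := rfl
  right_inv _ := rfl

lemma finrank_WW_comm (E F : Submodule ℂ M3) : finrank ℂ (WW E F) = finrank ℂ (WW F E) := by
  have : WW F E = (WW E F).map swapT.toLinearMap := by
    ext θ; constructor
    · intro h; exact ⟨fun a b k => θ b a k, ⟨h.2, h.1⟩, rfl⟩
    · rintro ⟨θ', h, rfl⟩; exact ⟨h.2, h.1⟩
  rw [this, LinearEquiv.finrank_map_eq swapT]

lemma SS_le_WW (E : Submodule ℂ M3) : SS E ≤ WW E E := by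
  intro θ h
  refine ⟨h.2, fun a => ?_⟩
  convert h.2 a using 1
  funext b k; exact h.1 a b k

/-- a non-scalar matrix has a row vector which is not an eigenvector -/
lemma exists_noneig (Y : M3) (hY : ∀ c : ℂ, Y ≠ c • idM) :
    ∃ η : Fin 3 → ℂ, ∀ s t : ℂ, (∀ k, s * η k + t * (∑ b, η b * Y b k) = 0) → s = 0 ∧ t = 0 := by
  by_contra hcon
  push Not at hcon
  have h2 : ∀ η : Fin 3 → ℂ, η ≠ 0 → ∃ c : ℂ, ∀ k, ∑ b, η b * Y b k = c * η k := by
    intro η hη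
    obtain ⟨s, t, h, hst⟩ := hcon η
    have ht : t ≠ 0 := by
      rintro rfl
      by_cases hs : s = 0
      · exact (hst hs) rfl
      · apply hη; funext k; have := h k; simpa [hs] using this
    refine ⟨-s / t, fun k => ?_⟩
    have := h k
    field_simp
    linear_combination this
  obtain ⟨c0, h0⟩ := h2 (Pi.single 0 1) (by intro h; simpa using congrFun h 0)
  obtain ⟨c1, h1⟩ := h2 (Pi.single 1 1) (by intro h; simpa using congrFun h 1)
  obtain ⟨c2, h2'⟩ := h2 (Pi.single 2 1) (by intro h; simpa using congrFun h 2)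
  obtain ⟨c, hc⟩ := h2 (fun _ => 1) (by intro h; simpa using congrFun h 0)
  simp [Fin.sum_univ_three, Fin.forall_fin_succ] at h0 h1 h2' hc
  apply hY c
  obtain ⟨a1, a2, a3⟩ := h0
  obtain ⟨b1, b2, b3⟩ := h1
  obtain ⟨d1, d2, d3⟩ := h2'
  obtain ⟨e1, e2, e3⟩ := hc
  funext i j
  fin_cases i <;> fin_cases j <;> simp_all [idM]

lemma det_rank2 (v x y z : Fin 3 → ℂ) : (fun a k => v a * x k + y a * z k) ≠ idM := by
  intro h
  have e : ∀ a k, v a * x k + y a * z k = idM a k := fun a k => congrFun (congrFun h a) k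
  have e00 := e 0 0; have e01 := e 0 1; have e02 := e 0 2
  have e10 := e 1 0; have e11 := e 1 1; have e12 := e 1 2
  have e20 := e 2 0; have e21 := e 2 1; have e22 := e 2 2
  simp [idM] at e00 e01 e02 e10 e11 e12 e20 e21 e22
  have hz : (v 0 * x 0 + y 0 * z 0) * ((v 1 * x 1 + y 1 * z 1) * (v 2 * x 2 + y 2 * z 2)
      - (v 1 * x 2 + y 1 * z 2) * (v 2 * x 1 + y 2 * z 1))
      - (v 0 * x 1 + y 0 * z 1) * ((v 1 * x 0 + y 1 * z 0) * (v 2 * x 2 + y 2 * z 2)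
      - (v 1 * x 2 + y 1 * z 2) * (v 2 * x 0 + y 2 * z 0))
      + (v 0 * x 2 + y 0 * z 2) * ((v 1 * x 0 + y 1 * z 0) * (v 2 * x 1 + y 2 * z 1)
      - (v 1 * x 1 + y 1 * z 1) * (v 2 * x 0 + y 2 * z 0)) = 0 := by ring
  rw [e00, e01, e02, e10, e11, e12, e20, e21, e22] at hz
  norm_num at hz

lemma exists_nonscalar {F : Submodule ℂ M3} (h2 : 2 ≤ finrank ℂ F) :
    ∃ Y ∈ F, ∀ c : ℂ, Y ≠ c • idM := by
  by_contra hcon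
  push Not at hcon
  have : F ≤ Submodule.span ℂ {idM} := by
    intro Y hY
    obtain ⟨c, hc⟩ := hcon Y hY
    rw [hc]; exact Submodule.smul_mem _ _ (Submodule.mem_span_singleton_self _)
  have h3 := Submodule.finrank_mono this
  have h4 := finrank_span_singleton (K := ℂ) idM_ne
  omega

/-- if `F` has dimension two then the intersection is smaller than `E`. -/
lemma finrank_WW_one (E F : Submodule ℂ M3) (hE : idM ∈ E) (hF : idM ∈ F)
    (h2 : finrank ℂ F = 2) : finrank ℂ (WW E F) + 1 ≤ finrank ℂ E := by
  obtain ⟨Y, hYF, hY⟩ := exists_nonscalar (F := F) (by omega)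
  have hspan : ∀ X ∈ F, ∃ s t : ℂ, X = s • idM + t • Y := by
    have hli : LinearIndependent ℂ ![idM, Y] := by
      rw [LinearIndependent.pair_iff]
      intro s t h
      have ht : t = 0 := by
        by_contra ht
        apply hY (-(s / t))
        have : t • Y = t • (-(s / t)) • idM := by
          rw [smul_smul]; rw [show t * -(s / t) = -s by field_simp]
          rw [neg_smul]; exact eq_neg_of_add_eq_zero_right h
        exact smul_right_injective _ ht this
      subst ht
      simp only [zero_smul, add_zero, smul_eq_zero] at h
      exact ⟨h.resolve_right idM_ne, rfl⟩
    have hle : Submodule.span ℂ (Set.range ![idM, Y]) ≤ F := by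
      rw [Submodule.span_le]; rintro _ ⟨i, rfl⟩
      fin_cases i
      · exact hF
      · exact hYF
    have heq := Submodule.eq_of_le_of_finrank_eq hle (by rw [finrank_span_eq_card hli, h2]; simp)
    intro X hX
    rw [← heq] at hX
    simp only [Matrix.range_cons, Matrix.range_empty, Set.union_empty,
      Set.union_singleton] at hX
    rw [Set.pair_comm] at hX
    obtain ⟨s, t, h⟩ := Submodule.mem_span_pair.1 hX
    exact ⟨s, t, h.symm⟩
  obtain ⟨η, hη⟩ := exists_noneig Y hY
  let Ψ : WW E F →ₗ[ℂ] E :=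
    { toFun := fun θ => ⟨fun a k => ∑ b, η b * θ.1 a b k, by
        have := E.sum_mem (t := Finset.univ) (f := fun b => η b • (fun a k => θ.1 a b k))
            (fun b _ => E.smul_mem _ (θ.2.1 b))
        convert this using 1
        funext b k; simp [Finset.sum_apply]⟩
      map_add' := fun θ θ' => by
        apply Subtype.ext; funext a k; simp [mul_add, Finset.sum_add_distrib]
      map_smul' := fun c θ => by
        apply Subtype.ext; funext a k; simp [Finset.mul_sum, mul_left_comm] }
  have hst : ∀ θ : WW E F, ∃ s t : Fin 3 → ℂ, ∀ a b k, θ.1 a b k = s a * idM b k + t a * Y b k := by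
    intro θ
    choose s t h using fun a => hspan _ (θ.2.2 a)
    refine ⟨s, t, fun a b k => ?_⟩
    simpa using congrFun (congrFun (h a) b) k
  have hval : ∀ (θ : WW E F) (s t : Fin 3 → ℂ), (∀ a b k, θ.1 a b k = s a * idM b k + t a * Y b k) →
      ∀ a k, (Ψ θ).1 a k = s a * η k + t a * ∑ b, η b * Y b k := by
    intro θ s t h a k
    simp only [Ψ, LinearMap.coe_mk, AddHom.coe_mk, h]
    fin_cases k <;> simp [Fin.sum_univ_three, idM] <;> ring
  have hinj : Function.Injective Ψ := by
    rw [← LinearMap.ker_eq_bot, LinearMap.ker_eq_bot']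
    intro θ h
    obtain ⟨s, t, hs⟩ := hst θ
    have h1 := hval θ s t hs
    apply Subtype.ext; funext a b k
    have h3 := hη (s a) (t a) (fun k => by rw [← h1 a k, h]; rfl)
    rw [hs, h3.1, h3.2]; simp
  have hns : LinearMap.range Ψ < ⊤ := by
    rw [lt_top_iff_ne_top]
    intro htop
    obtain ⟨θ, hθ⟩ := LinearMap.range_eq_top.1 htop ⟨idM, hE⟩
    obtain ⟨s, t, hs⟩ := hst θ
    have h1 := hval θ s t hs
    apply det_rank2 s η t (fun k => ∑ b, η b * Y b k)
    funext a k
    rw [← h1 a k, hθ]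
  have h5 := Submodule.finrank_lt hns.ne
  rw [LinearMap.finrank_range_of_inj hinj] at h5
  omega

end SecM1

section SecM1b
open Module

lemma finrank_split_eq {V U : Type*} [AddCommGroup V] [Module ℂ V] [AddCommGroup U] [Module ℂ U]
    [FiniteDimensional ℂ V] (L : V →ₗ[ℂ] U) (W : Submodule ℂ V) :
    finrank ℂ W = finrank ℂ (W.map L) + finrank ℂ (W ⊓ LinearMap.ker L : Submodule ℂ V) := by
  have h1 := LinearMap.finrank_range_add_finrank_ker (L.domRestrict W)
  rw [LinearMap.range_domRestrict] at h1
  have h2 : (LinearMap.ker (L.domRestrict W)).map W.subtype = W ⊓ LinearMap.ker L := by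
    ext x; simp [Submodule.mem_map, LinearMap.mem_ker, LinearMap.domRestrict_apply, and_comm]
  have h3 : finrank ℂ ((LinearMap.ker (L.domRestrict W)).map W.subtype)
      = finrank ℂ (LinearMap.ker (L.domRestrict W)) :=
    Submodule.finrank_map_subtype_eq _ _
  rw [h2] at h3
  omega

lemma finrank_split {V U : Type*} [AddCommGroup V] [Module ℂ V] [AddCommGroup U] [Module ℂ U]
    [FiniteDimensional ℂ V] [FiniteDimensional ℂ U] (L : V →ₗ[ℂ] U) (W : Submodule ℂ V)
    (F : Submodule ℂ U) (h : ∀ x ∈ W, L x ∈ F) :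
    finrank ℂ W ≤ finrank ℂ F + finrank ℂ (W ⊓ LinearMap.ker L : Submodule ℂ V) := by
  have h1 := finrank_split_eq L W
  have h2 : finrank ℂ (W.map L) ≤ finrank ℂ F :=
    Submodule.finrank_mono (by rintro _ ⟨x, hx, rfl⟩; exact h x hx)
  omega

def ctM (η : Fin 3 → ℂ) : M3 →ₗ[ℂ] (Fin 3 → ℂ) where
  toFun X := fun k => ∑ a, η a * X a k
  map_add' X Y := by funext k; simp [mul_add, Finset.sum_add_distrib]
  map_smul' c X := by funext k; simp [Finset.mul_sum, mul_left_comm]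

def ctT (η : Fin 3 → ℂ) : T3 →ₗ[ℂ] M3 where
  toFun θ := fun a k => ∑ b, η b * θ a b k
  map_add' X Y := by funext a k; simp [mul_add, Finset.sum_add_distrib]
  map_smul' c X := by funext a k; simp [Finset.mul_sum, mul_left_comm]

lemma ctT_mem {E : Submodule ℂ M3} {θ : T3} (h : θ ∈ SS E) (η : Fin 3 → ℂ) : ctT η θ ∈ E := by
  have := E.sum_mem (t := Finset.univ) (f := fun b => η b • (fun a k => θ a b k))
    (fun b _ => E.smul_mem _ (h.2 b))
  convert this using 1
  funext a k; simp [ctT, Finset.sum_apply]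

lemma ctM_ctT {E : Submodule ℂ M3} {θ : T3} (h : θ ∈ SS E) (η η' : Fin 3 → ℂ) :
    ctM η (ctT η' θ) = ctM η' (ctT η θ) := by
  funext k
  simp only [ctM, ctT, LinearMap.coe_mk, AddHom.coe_mk, Finset.mul_sum]
  rw [Finset.sum_comm]
  refine Finset.sum_congr rfl fun b _ => Finset.sum_congr rfl fun a _ => ?_
  rw [h.1 a b k]; ring

def SepV (η η2 η3 : Fin 3 → ℂ) : Prop := ∀ x : Fin 3 → ℂ, (∑ a, η a * x a = 0) →
  (∑ a, η2 a * x a = 0) → (∑ a, η3 a * x a = 0) → x = 0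

lemma exists_sep (η : Fin 3 → ℂ) (h : η ≠ 0) : ∃ η2 η3, SepV η η2 η3 ∧ SepV η η3 η2 := by
  have : ∃ i, η i ≠ 0 := by
    by_contra hc; push Not at hc; exact h (funext hc)
  have key : ∃ η2 η3, SepV η η2 η3 := by
    obtain ⟨i, hi⟩ := this
    fin_cases i
    · refine ⟨![0,1,0], ![0,0,1], fun x h1 h2 h3 => ?_⟩
      simp [Fin.sum_univ_three] at h1 h2 h3 hi
      funext j; fin_cases j <;> simp_all
    · refine ⟨![1,0,0], ![0,0,1], fun x h1 h2 h3 => ?_⟩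
      simp [Fin.sum_univ_three] at h1 h2 h3 hi
      funext j; fin_cases j <;> simp_all
    · refine ⟨![1,0,0], ![0,1,0], fun x h1 h2 h3 => ?_⟩
      simp [Fin.sum_univ_three] at h1 h2 h3 hi
      funext j; fin_cases j <;> simp_all
  obtain ⟨a, b, hab⟩ := key
  exact ⟨a, b, hab, fun x h1 h2 h3 => hab x h1 h3 h2⟩

lemma finrank_SS_sep (E : Submodule ℂ M3) {η η2 η3 : Fin 3 → ℂ} (h : SepV η η2 η3) :
    finrank ℂ (SS E) ≤ finrank ℂ E + finrank ℂ (E ⊓ LinearMap.ker (ctM η) : Submodule ℂ M3)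
      + finrank ℂ (E ⊓ LinearMap.ker (ctM η) ⊓ LinearMap.ker (ctM η2) : Submodule ℂ M3) := by
  have h1 := finrank_split (ctT η) (SS E) E (fun θ hθ => ctT_mem hθ η)
  have h2 := finrank_split (ctT η2) (SS E ⊓ LinearMap.ker (ctT η)) (E ⊓ LinearMap.ker (ctM η))
    (fun θ hθ => ⟨ctT_mem hθ.1 η2, by
      rw [SetLike.mem_coe, LinearMap.mem_ker, ctM_ctT hθ.1, LinearMap.mem_ker.1 hθ.2, map_zero]⟩)
  have h3 := finrank_split (ctT η3) (SS E ⊓ LinearMap.ker (ctT η) ⊓ LinearMap.ker (ctT η2))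
    (E ⊓ LinearMap.ker (ctM η) ⊓ LinearMap.ker (ctM η2))
    (fun θ hθ => ⟨⟨ctT_mem hθ.1.1 η3, by
      rw [SetLike.mem_coe, LinearMap.mem_ker, ctM_ctT hθ.1.1, LinearMap.mem_ker.1 hθ.1.2, map_zero]⟩, by
      rw [SetLike.mem_coe, LinearMap.mem_ker, ctM_ctT hθ.1.1, LinearMap.mem_ker.1 hθ.2, map_zero]⟩)
  have h4 : (SS E ⊓ LinearMap.ker (ctT η) ⊓ LinearMap.ker (ctT η2) ⊓ LinearMap.ker (ctT η3)
      : Submodule ℂ T3) = ⊥ := by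
    rw [eq_bot_iff]
    rintro θ ⟨⟨⟨_, k1⟩, k2⟩, k3⟩
    rw [Submodule.mem_bot]
    funext a b k
    exact congrFun (h (fun b => θ a b k) (congrFun (congrFun k1 a) k)
      (congrFun (congrFun k2 a) k) (congrFun (congrFun k3 a) k)) b
  rw [h4, finrank_bot] at h3
  omega

lemma ker_sep (E : Submodule ℂ M3) {η η2 η3 : Fin 3 → ℂ} (h : SepV η η2 η3) :
    (E ⊓ LinearMap.ker (ctM η) ⊓ LinearMap.ker (ctM η2) ⊓ LinearMap.ker (ctM η3)
      : Submodule ℂ M3) = ⊥ := by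
  rw [eq_bot_iff]
  rintro X ⟨⟨⟨_, k1⟩, k2⟩, k3⟩
  rw [Submodule.mem_bot]
  funext a k
  exact congrFun (h (fun a => X a k) (congrFun k1 k) (congrFun k2 k) (congrFun k3 k)) a

lemma finrank_SS_le (E : Submodule ℂ M3) (hE : idM ∈ E) (h2 : 2 ≤ finrank ℂ E) :
    ∃ p q, finrank ℂ (SS E) ≤ finrank ℂ E + p + q ∧ p + 2 ≤ finrank ℂ E ∧ p ≤ 6 ∧ 2 * q ≤ p
      ∧ q ≤ 3 := by
  obtain ⟨Y, hYE, hY⟩ := exists_nonscalar h2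
  obtain ⟨η, hη⟩ := exists_noneig Y hY
  have hη0 : η ≠ 0 := by
    rintro rfl
    have := hη 1 0 (fun k => by simp)
    simp at this
  obtain ⟨η2, η3, hs, hs'⟩ := exists_sep η hη0
  have a1 := finrank_SS_sep E hs
  have a2 := finrank_SS_sep E hs'
  have b1 := finrank_split (ctM η2) (E ⊓ LinearMap.ker (ctM η)) ⊤ (fun _ _ => trivial)
  have b2 := finrank_split (ctM η3) (E ⊓ LinearMap.ker (ctM η) ⊓ LinearMap.ker (ctM η2)) ⊤
    (fun _ _ => trivial)
  have b3 := finrank_split (ctM η2) (E ⊓ LinearMap.ker (ctM η) ⊓ LinearMap.ker (ctM η3)) ⊤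
    (fun _ _ => trivial)
  rw [ker_sep E hs] at b2
  rw [ker_sep E hs'] at b3
  have h3 : finrank ℂ (⊤ : Submodule ℂ (Fin 3 → ℂ)) = 3 := by simp
  rw [h3, finrank_bot] at b2 b3
  rw [h3] at b1
  have c1 := finrank_split_eq (ctM η) E
  have c2 : 2 ≤ finrank ℂ (E.map (ctM η)) := by
    have hli : LinearIndependent ℂ ![ctM η idM, ctM η Y] := by
      rw [LinearIndependent.pair_iff]
      intro s t h
      apply hη s t
      intro k
      have := congrFun h k
      simpa [ctM, idM] using this
    have hle : Submodule.span ℂ (Set.range ![ctM η idM, ctM η Y]) ≤ E.map (ctM η) := by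
      rw [Submodule.span_le]; rintro _ ⟨i, rfl⟩
      fin_cases i
      · exact ⟨_, hE, rfl⟩
      · exact ⟨_, hYE, rfl⟩
    have := Submodule.finrank_mono hle
    rw [finrank_span_eq_card hli] at this
    simpa using this
  have d1 := Submodule.finrank_sup_add_finrank_inf_eq
    (E ⊓ LinearMap.ker (ctM η) ⊓ LinearMap.ker (ctM η2))
    (E ⊓ LinearMap.ker (ctM η) ⊓ LinearMap.ker (ctM η3))
  have d2 : finrank ℂ (E ⊓ LinearMap.ker (ctM η) ⊓ LinearMap.ker (ctM η2) ⊔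
    (E ⊓ LinearMap.ker (ctM η) ⊓ LinearMap.ker (ctM η3)) : Submodule ℂ M3)
     ≤ finrank ℂ (E ⊓ LinearMap.ker (ctM η) : Submodule ℂ M3) :=
    Submodule.finrank_mono (sup_le inf_le_left inf_le_left)
  have d3 : (E ⊓ LinearMap.ker (ctM η) ⊓ LinearMap.ker (ctM η2) ⊓
    (E ⊓ LinearMap.ker (ctM η) ⊓ LinearMap.ker (ctM η3)) : Submodule ℂ M3) = ⊥ := by
    rw [eq_bot_iff, ← ker_sep E hs]
    exact le_inf inf_le_left (inf_le_right.trans inf_le_right)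
  rw [d3, finrank_bot] at d1
  refine ⟨finrank ℂ (E ⊓ LinearMap.ker (ctM η) : Submodule ℂ M3), min (finrank ℂ (E ⊓ LinearMap.ker (ctM η) ⊓ LinearMap.ker (ctM η2) : Submodule ℂ M3))
    (finrank ℂ (E ⊓ LinearMap.ker (ctM η) ⊓ LinearMap.ker (ctM η3) : Submodule ℂ M3)),
    ?_, ?_, ?_, ?_, ?_⟩
  all_goals omega

/-- matrices with columns in `A` -/
def Qs (A : Submodule ℂ (Fin 3 → ℂ)) : Submodule ℂ M3 where
  carrier := {X | ∀ k, (fun a => X a k) ∈ A}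
  zero_mem' := fun _ => A.zero_mem
  add_mem' := fun h1 h2 k => A.add_mem (h1 k) (h2 k)
  smul_mem' := fun c _ h k => A.smul_mem c (h k)

lemma finrank_Qs (A : Submodule ℂ (Fin 3 → ℂ)) : finrank ℂ (Qs A) = 3 * finrank ℂ A := by
  let e : Qs A ≃ₗ[ℂ] (Fin 3 → A) :=
    { toFun := fun X k => ⟨fun a => X.1 a k, X.2 k⟩
      invFun := fun Y => ⟨fun a k => (Y k).1 a, fun k => (Y k).2⟩
      map_add' := fun _ _ => rfl
      map_smul' := fun _ _ => rfl
      left_inv := fun _ => rfl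
      right_inv := fun _ => rfl }
  rw [e.finrank_eq, Module.finrank_pi_fintype]; simp

lemma Qs_Av_le (E : Submodule ℂ M3) : Qs (Av E) ≤ E := by
  intro X hX
  have := E.sum_mem (t := Finset.univ) (fun k _ => hX k (Pi.single k 1))
  convert this using 1
  funext a k
  simp [Finset.sum_apply, Pi.single_apply]

lemma trE_mono {E F : Submodule ℂ M3} (h : E ≤ F) : trE E ≤ trE F := Submodule.map_mono h

lemma trQs_Av_le (E : Submodule ℂ M3) : trE (Qs (Av (trE E))) ≤ E := by
  have := trE_mono (Qs_Av_le (trE E))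
  rwa [trE_trE] at this

lemma finrank_inf_Qs (A B : Submodule ℂ (Fin 3 → ℂ)) :
    finrank ℂ (Qs A ⊓ trE (Qs B) : Submodule ℂ M3) ≤ finrank ℂ B * finrank ℂ A := by
  let e : B ≃ₗ[ℂ] (Fin (finrank ℂ B) → ℂ) := LinearEquiv.ofFinrankEq _ _ (by simp)
  obtain ⟨π, hπ⟩ := LinearMap.exists_extend e.toLinearMap
  have hexp : ∀ (x : Fin 3 → ℂ), π x = ∑ k, x k • π (Pi.single k 1) := by
    intro x
    conv_lhs => rw [pi_eq_sum_univ' x]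
    rw [map_sum]
    refine Finset.sum_congr rfl fun k _ => ?_
    rw [map_smul]
  let Ψ : (Qs A ⊓ trE (Qs B) : Submodule ℂ M3) →ₗ[ℂ] (Fin (finrank ℂ B) → A) :=
    { toFun := fun X j => ⟨fun a => π (X.1 a) j, by
        have := A.sum_mem (t := Finset.univ)
          (fun k _ => A.smul_mem (π (Pi.single k 1) j) (X.2.1 k))
        convert this using 1
        funext a; rw [hexp]; simp [Finset.sum_apply, mul_comm]⟩
      map_add' := fun X Y => by
        funext j; apply Subtype.ext; funext a; simp
      map_smul' := fun c X => by
        funext j; apply Subtype.ext; funext a; simp }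
  have hinj : Function.Injective Ψ := by
    rw [← LinearMap.ker_eq_bot, LinearMap.ker_eq_bot']
    intro X hX
    apply Subtype.ext
    funext a
    have hB : X.1 a ∈ B := (mem_trE.1 X.2.2) a
    have h0 : π (X.1 a) = 0 := by
      funext j; exact congrFun (congrArg Subtype.val (congrFun hX j)) a
    have h1 : e ⟨X.1 a, hB⟩ = 0 := by
      rw [← h0]; exact (LinearMap.congr_fun hπ ⟨X.1 a, hB⟩).symm
    have h2 := e.map_eq_zero_iff.1 h1
    exact congrArg Subtype.val h2
  have := LinearMap.finrank_le_finrank_of_injective hinj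
  rw [Module.finrank_pi_fintype] at this
  simpa using this

lemma alpha_le (E : Submodule ℂ M3) (hE : idM ∈ E) :
    finrank ℂ (Av E) ≤ 3 ∧ 3 * finrank ℂ (Av E) ≤ finrank ℂ E ∧
    (finrank ℂ (Av E) < 3 → 3 * finrank ℂ (Av E) + 1 ≤ finrank ℂ E) := by
  have h1 : finrank ℂ (Av E) ≤ 3 := by
    have := Submodule.finrank_le (Av E); simpa using this
  have h2 := Submodule.finrank_mono (Qs_Av_le E)
  rw [finrank_Qs] at h2
  refine ⟨h1, h2, fun h3 => ?_⟩
  by_contra hcon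
  have heq : Qs (Av E) = E := Submodule.eq_of_le_of_finrank_eq (Qs_Av_le E) (by
    rw [finrank_Qs]; omega)
  have htop : Av E = ⊤ := by
    rw [eq_top_iff]
    intro x _
    have hid : idM ∈ Qs (Av E) := by rw [heq]; exact hE
    have := (Av E).sum_mem (t := Finset.univ) (fun k _ => (Av E).smul_mem (x k) (hid k))
    convert this using 1
    funext a; simp [Finset.sum_apply, idM]
  rw [htop] at h3
  simp at h3

lemma alpha_beta (E : Submodule ℂ M3) (hE : idM ∈ E) :
    3 * finrank ℂ (Av E) + 3 * finrank ℂ (Av (trE E)) ≤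
      finrank ℂ E + finrank ℂ (Av (trE E)) * finrank ℂ (Av E) ∧
    (finrank ℂ (Av E) = 1 → finrank ℂ (Av (trE E)) = 1 → 6 ≤ finrank ℂ E) := by
  have h1 := Submodule.finrank_sup_add_finrank_inf_eq (Qs (Av E)) (trE (Qs (Av (trE E))))
  have h2 := finrank_inf_Qs (Av E) (Av (trE E))
  have hle := sup_le (Qs_Av_le E) (trQs_Av_le E)
  have h3 := Submodule.finrank_mono hle
  rw [finrank_trE, finrank_Qs, finrank_Qs] at h1
  refine ⟨by omega, fun ha hb => ?_⟩
  have hlt : Qs (Av E) ⊔ trE (Qs (Av (trE E))) < E := by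
    refine lt_of_le_of_ne hle ?_
    intro heq
    rw [← heq] at hE
    obtain ⟨X, hX, Y, hY, hXY⟩ := Submodule.mem_sup.1 hE
    obtain ⟨⟨v, hv⟩, hv0, hv'⟩ := finrank_eq_one_iff'.1 ha
    obtain ⟨⟨ξ, hξ⟩, hξ0, hξ'⟩ := finrank_eq_one_iff'.1 hb
    choose x hx using fun k => hv' ⟨_, hX k⟩
    choose y hy using fun a => hξ' ⟨_, mem_trE.1 hY a⟩
    apply det_rank2 v x y ξ
    rw [← hXY]
    funext a k
    have e1 := congrFun (congrArg Subtype.val (hx k)) a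
    have e2 := congrFun (congrArg Subtype.val (hy a)) k
    simp at e1 e2
    rw [Pi.add_apply, Pi.add_apply, ← e1, ← e2]; ring
  have := Submodule.finrank_lt_finrank_of_lt hlt
  rw [ha, hb] at h2
  omega

end SecM1b

section SecM2
open Module

section Filt
variable {ι U : Type*} [Fintype ι] [AddCommGroup U] [Module ℂ U]

/-- space of leading terms at position `i`. -/
def inn (wt : ι → ℕ) (W : Submodule ℂ (ι → U)) (i : ι) : Submodule ℂ U where
  carrier := {X | ∃ e ∈ W, e i = X ∧ ∀ j, wt i < wt j → e j = 0}
  zero_mem' := ⟨0, W.zero_mem, rfl, fun _ _ => rfl⟩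
  add_mem' := by
    rintro X Y ⟨e, he, h1, h2⟩ ⟨e', he', h1', h2'⟩
    exact ⟨e + e', W.add_mem he he', by simp [h1, h1'], fun j hj => by simp [h2 j hj, h2' j hj]⟩
  smul_mem' := by
    rintro c X ⟨e, he, h1, h2⟩
    exact ⟨c • e, W.smul_mem c he, by simp [h1], fun j hj => by simp [h2 j hj]⟩

/-- the members of `W` supported in weights below `m` -/
def filtW (wt : ι → ℕ) (W : Submodule ℂ (ι → U)) (m : ℕ) : Submodule ℂ (ι → U) where
  carrier := {e | e ∈ W ∧ ∀ j, m ≤ wt j → e j = 0}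
  zero_mem' := ⟨W.zero_mem, fun _ _ => rfl⟩
  add_mem' := by
    rintro e e' ⟨he, h2⟩ ⟨he', h2'⟩
    exact ⟨W.add_mem he he', fun j hj => by simp [h2 j hj, h2' j hj]⟩
  smul_mem' := by
    rintro c e ⟨he, h2⟩
    exact ⟨W.smul_mem c he, fun j hj => by simp [h2 j hj]⟩

lemma finrank_filt [FiniteDimensional ℂ U] (wt : ι → ℕ) (hwt : Function.Injective wt)
    (W : Submodule ℂ (ι → U)) (m : ℕ) :
    finrank ℂ (filtW wt W m) = ∑ i, if wt i < m then finrank ℂ (inn wt W i) else 0 := by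
  classical
  induction m with
  | zero =>
    have : filtW wt W 0 = ⊥ := by
      rw [eq_bot_iff]; rintro e ⟨_, h⟩
      rw [Submodule.mem_bot]; funext j; exact h j (Nat.zero_le _)
    rw [this, finrank_bot]; simp
  | succ m ih =>
    by_cases hex : ∃ i, wt i = m
    · obtain ⟨i, hi⟩ := hex
      have h1 := finrank_split_eq (LinearMap.proj i : (ι → U) →ₗ[ℂ] U) (filtW wt W (m+1))
      have h2 : (filtW wt W (m+1)).map (LinearMap.proj i : (ι → U) →ₗ[ℂ] U) = inn wt W i := by
        ext X; constructor
        · rintro ⟨e, ⟨he, h⟩, rfl⟩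
          exact ⟨e, he, rfl, fun j hj => h j (by omega)⟩
        · rintro ⟨e, he, h, h'⟩
          exact ⟨e, ⟨he, fun j hj => h' j (by omega)⟩, h⟩
      have h3 : (filtW wt W (m+1)) ⊓ LinearMap.ker (LinearMap.proj i : (ι → U) →ₗ[ℂ] U)
          = filtW wt W m := by
        ext e; constructor
        · rintro ⟨⟨he, h⟩, h0⟩
          refine ⟨he, fun j hj => ?_⟩
          by_cases hj' : wt j = m
          · rw [hwt (hj'.trans hi.symm)]; exact h0
          · exact h j (by omega)
        · rintro ⟨he, h⟩
          exact ⟨⟨he, fun j hj => h j (by omega)⟩, h i (by omega)⟩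
      rw [h1, h2, h3, ih]
      have h4 : ∀ j, (if wt j < m + 1 then finrank ℂ (inn wt W j) else 0)
          = (if j = i then finrank ℂ (inn wt W j) else 0)
            + if wt j < m then finrank ℂ (inn wt W j) else 0 := by
        intro j
        by_cases hj : j = i
        · subst hj; simp [hi]
        · have : wt j ≠ m := fun h => hj (hwt (h.trans hi.symm))
          simp only [hj, if_false, zero_add]
          congr 1
          simp only [eq_iff_iff]; omega
      rw [Finset.sum_congr rfl fun j _ => h4 j, Finset.sum_add_distrib]
      simp
    · have h3 : filtW wt W (m+1) = filtW wt W m := by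
        ext e; constructor
        · rintro ⟨he, h⟩
          exact ⟨he, fun j hj => h j (by
            have : wt j ≠ m := fun h => hex ⟨j, h⟩
            omega)⟩
        · rintro ⟨he, h⟩
          exact ⟨he, fun j hj => h j (by omega)⟩
      rw [h3, ih]
      refine Finset.sum_congr rfl fun j _ => ?_
      have : wt j ≠ m := fun h => hex ⟨j, h⟩
      congr 1
      simp only [eq_iff_iff]; omega

lemma finrank_eq_sum_inn [FiniteDimensional ℂ U] (wt : ι → ℕ) (hwt : Function.Injective wt)
    (W : Submodule ℂ (ι → U)) : finrank ℂ W = ∑ i, finrank ℂ (inn wt W i) := by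
  obtain ⟨m, hm⟩ : ∃ m, ∀ i, wt i < m := by
    refine ⟨∑ i, wt i + 1, fun i => ?_⟩
    have := Finset.single_le_sum (f := wt) (fun _ _ => Nat.zero_le _) (Finset.mem_univ i)
    omega
  have h1 := finrank_filt wt hwt W m
  have h2 : filtW wt W m = W := by
    ext e; constructor
    · exact fun h => h.1
    · exact fun h => ⟨h, fun j hj => absurd (hm j) (by omega)⟩
  rw [h2] at h1
  rw [h1]; simp [hm]
end Filt

/-- the (2,1,0) prolongation -/
def K210 {n : ℕ} (E : Submodule ℂ (Fin n × Fin n → M3)) :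
    Submodule ℂ (Fin n × Fin n × Fin n → T3) where
  carrier := {θ | (∀ s1 s2 t a b k, θ (s1,s2,t) a b k = θ (s2,s1,t) b a k) ∧
    ∀ s2 b, (fun (p : Fin n × Fin n) a k => θ (p.1,s2,p.2) a b k) ∈ E}
  zero_mem' := ⟨fun _ _ _ _ _ _ => rfl, fun _ _ => E.zero_mem⟩
  add_mem' := fun h1 h2 => ⟨fun s1 s2 t a b k => by
      simp only [Pi.add_apply]; rw [h1.1 s1, h2.1 s1], fun s b => E.add_mem (h1.2 s b) (h2.2 s b)⟩
  smul_mem' := fun c _ h => ⟨fun s1 s2 t a b k => by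
      simp only [Pi.smul_apply]; rw [h.1 s1], fun s b => E.smul_mem c (h.2 s b)⟩

/-- transpose of everything -/
def tG {n : ℕ} (E : Submodule ℂ (Fin n × Fin n → M3)) :
    Submodule ℂ (Fin n × Fin n → M3) where
  carrier := {e | (fun (p : Fin n × Fin n) a k => e (p.2,p.1) k a) ∈ E}
  zero_mem' := E.zero_mem
  add_mem' := fun h1 h2 => E.add_mem h1 h2
  smul_mem' := fun c _ h => E.smul_mem c h

def wtp {n : ℕ} (ω τ : Fin n → ℕ) : Fin n × Fin n → ℕ := fun p => ω p.1 + τ p.2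

lemma inn_tG {n : ℕ} (E : Submodule ℂ (Fin n × Fin n → M3)) (ω τ : Fin n → ℕ) (s t : Fin n) :
    inn (wtp τ ω) (tG E) (t,s) = trE (inn (wtp ω τ) E (s,t)) := by
  ext X
  rw [mem_trE]
  constructor
  · rintro ⟨e, he, h, h'⟩
    refine ⟨_, he, ?_, fun j hj => ?_⟩
    · funext a k; rw [← h]
    · have := h' (j.2,j.1) (by simp only [wtp] at hj ⊢; omega)
      funext a k; simp [this]
  · rintro ⟨e, he, h, h'⟩
    refine ⟨fun p a k => e (p.2,p.1) k a, he, ?_, fun j hj => ?_⟩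
    · funext a k; exact congrFun (congrFun h k) a
    · have := h' (j.2,j.1) (by simp only [wtp] at hj ⊢; omega)
      funext a k; simp [this]

lemma sum_le_sym {n : ℕ} (f : Fin n → Fin n → ℕ) (hf : ∀ a b, f a b = f b a) :
    2 * ∑ a, ∑ b, (if a ≤ b then f a b else 0) =
      2 * ∑ a, f a a + ∑ a, ∑ b, if a = b then 0 else f a b := by
  have h1 : ∑ a, ∑ b, (if a ≤ b then f a b else 0) = ∑ a, ∑ b, if b ≤ a then f a b else 0 := by
    rw [Finset.sum_comm]
    refine Finset.sum_congr rfl fun a _ => Finset.sum_congr rfl fun b _ => ?_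
    rw [hf]
  have h2 : ∑ a, f a a = ∑ a, ∑ b, if a = b then f a b else 0 := by
    simp
  rw [two_mul]
  nth_rw 2 [h1]
  rw [h2, two_mul, ← Finset.sum_add_distrib, ← Finset.sum_add_distrib, ← Finset.sum_add_distrib]
  refine Finset.sum_congr rfl fun a _ => ?_
  rw [← Finset.sum_add_distrib, ← Finset.sum_add_distrib, ← Finset.sum_add_distrib]
  refine Finset.sum_congr rfl fun b _ => ?_
  rcases lt_trichotomy a b with h | h | h
  · simp [h.le, h.ne, not_le.2 h]
  · subst h; simp
  · simp [h.le, h.ne', not_le.2 h]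

lemma finrank_K210_le {n : ℕ} (E : Submodule ℂ (Fin n × Fin n → M3)) (ω τ : Fin n → ℕ)
    (H : ∀ s1 s2 t s1' s2' t', s1 ≤ s2 → s1' ≤ s2' → ω s1 + ω s2 + τ t = ω s1' + ω s2' + τ t' →
      s1 = s1' ∧ s2 = s2' ∧ t = t') :
    2 * finrank ℂ (K210 E) ≤ ∑ t, (2 * ∑ s, finrank ℂ (SS (inn (wtp ω τ) E (s,t))) +
      ∑ s1, ∑ s2, if s1 = s2 then 0 else
        finrank ℂ (WW (inn (wtp ω τ) E (s1,t)) (inn (wtp ω τ) E (s2,t)))) := by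
  let ι := {p : Fin n × Fin n × Fin n // p.1 ≤ p.2.1}
  let L : (Fin n × Fin n × Fin n → T3) →ₗ[ℂ] (ι → T3) := LinearMap.funLeft ℂ T3 Subtype.val
  have h0 : K210 E ⊓ LinearMap.ker L = ⊥ := by
    rw [eq_bot_iff]
    rintro θ ⟨⟨hs, _⟩, hL⟩
    rw [Submodule.mem_bot]
    funext ⟨s1, s2, t⟩ a b k
    rcases le_total s1 s2 with h | h
    · exact congrFun (congrFun (congrFun (congrFun hL ⟨(s1,s2,t), h⟩) a) b) k
    · rw [hs]
      exact congrFun (congrFun (congrFun (congrFun hL ⟨(s2,s1,t), h⟩) b) a) k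
  have h1 := finrank_split_eq L (K210 E)
  rw [h0, finrank_bot, add_zero] at h1
  let wt : ι → ℕ := fun p => ω p.1.1 + ω p.1.2.1 + τ p.1.2.2
  have hwt : Function.Injective wt := by
    rintro ⟨⟨s1, s2, t⟩, h⟩ ⟨⟨s1', s2', t'⟩, h'⟩ heq
    obtain ⟨rfl, rfl, rfl⟩ := H s1 s2 t s1' s2' t' h h' heq
    rfl
  rw [finrank_eq_sum_inn wt hwt] at h1
  have hlead : ∀ s1 s2 t (h : s1 ≤ s2), ∀ X ∈ inn wt ((K210 E).map L) ⟨(s1,s2,t), h⟩,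
      ∃ θ ∈ K210 E, θ (s1,s2,t) = X ∧ ∀ s1' s2' t', ω s1 + ω s2 + τ t < ω s1' + ω s2' + τ t' →
        θ (s1',s2',t') = 0 := by
    rintro s1 s2 t h X ⟨_, ⟨θ, hθ, rfl⟩, hX, hz⟩
    refine ⟨θ, hθ, hX, fun s1' s2' t' hlt => ?_⟩
    rcases le_total s1' s2' with h' | h'
    · exact hz ⟨(s1',s2',t'), h'⟩ hlt
    · have := hz ⟨(s2',s1',t'), h'⟩ (by simp only [wt]; omega)
      funext a b k
      rw [hθ.1]
      exact congrFun (congrFun (congrFun this b) a) k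
  have hW : ∀ s1 s2 t (h : s1 ≤ s2), inn wt ((K210 E).map L) ⟨(s1,s2,t), h⟩ ≤
      WW (inn (wtp ω τ) E (s1,t)) (inn (wtp ω τ) E (s2,t)) := by
    intro s1 s2 t h X hX
    obtain ⟨θ, hθ, rfl, hz⟩ := hlead s1 s2 t h X hX
    refine ⟨fun b => ⟨_, hθ.2 s2 b, rfl, fun j hj => ?_⟩, fun a => ⟨_, hθ.2 s1 a, ?_, fun j hj => ?_⟩⟩
    · have := hz j.1 s2 j.2 (by simp only [wtp] at hj; omega)
      funext a k; simp [this]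
    · funext b k; exact hθ.1 _ _ _ _ _ _
    · have := hz j.1 s1 j.2 (by simp only [wtp] at hj; omega)
      funext a k; simp [this]
  have hS : ∀ s t, inn wt ((K210 E).map L) ⟨(s,s,t), le_refl s⟩ ≤ SS (inn (wtp ω τ) E (s,t)) := by
    intro s t X hX
    refine ⟨fun a b k => ?_, (hW s s t le_rfl hX).1⟩
    obtain ⟨θ, hθ, rfl, hz⟩ := hlead s s t le_rfl X hX
    exact hθ.1 _ _ _ _ _ _
  let B : Fin n × Fin n × Fin n → ℕ := fun p => if p.1 = p.2.1 then
    finrank ℂ (SS (inn (wtp ω τ) E (p.1,p.2.2))) else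
    finrank ℂ (WW (inn (wtp ω τ) E (p.1,p.2.2)) (inn (wtp ω τ) E (p.2.1,p.2.2)))
  have h2 : finrank ℂ (K210 E) ≤ ∑ p : ι, B p.1 := by
    rw [h1]
    refine Finset.sum_le_sum ?_
    rintro ⟨⟨s1, s2, t⟩, h⟩ _
    simp only [B]
    split_ifs with heq
    · subst heq; exact Submodule.finrank_mono (hS s1 t)
    · exact Submodule.finrank_mono (hW s1 s2 t h)
  have h3 : ∑ p : ι, B p.1 = ∑ t, ∑ s1, ∑ s2, if s1 ≤ s2 then B (s1,s2,t) else 0 := by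
    rw [← Finset.sum_subtype (Finset.univ.filter
      (fun p : Fin n × Fin n × Fin n => p.1 ≤ p.2.1)) (by simp) B, Finset.sum_filter,
      Fintype.sum_prod_type]
    simp_rw [Fintype.sum_prod_type]
    rw [Finset.sum_comm]
    conv_lhs => enter [2, y]; rw [Finset.sum_comm]
    rw [Finset.sum_comm]
    refine Finset.sum_congr rfl fun t _ => ?_
    rw [Finset.sum_comm]
  rw [h3] at h2
  refine (Nat.mul_le_mul_left 2 h2).trans ?_
  rw [Finset.mul_sum]
  refine Finset.sum_le_sum fun t _ => ?_
  rw [sum_le_sym (fun s1 s2 => B (s1,s2,t))]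
  · refine le_of_eq ?_
    congr 1
    · simp [B]
    · refine Finset.sum_congr rfl fun s1 _ => Finset.sum_congr rfl fun s2 _ => ?_
      split_ifs with h
      · rfl
      · simp [B, h]
  · intro a b
    simp only [B]
    by_cases h : a = b
    · subst h; rfl
    · rw [if_neg h, if_neg (Ne.symm h), finrank_WW_comm]

lemma pair_pow {a b c d : ℕ} (h1 : a ≤ b) (h2 : c ≤ d) (h : 2 ^ a + 2 ^ b = 2 ^ c + 2 ^ d) :
    a = c ∧ b = d := by
  have key : ∀ {a b c d : ℕ}, a ≤ b → 2 ^ a + 2 ^ b = 2 ^ c + 2 ^ d → ¬ b < d := by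
    intro a b c d h1 h hlt
    have e1 : 2 ^ a ≤ 2 ^ b := Nat.pow_le_pow_right (by norm_num) h1
    have e2 : 2 ^ (b + 1) ≤ 2 ^ d := Nat.pow_le_pow_right (by norm_num) hlt
    have e3 : 0 < 2 ^ c := by positivity
    rw [pow_succ] at e2
    omega
  have hbd : b = d := by
    have := key h1 h; have := key h2 h.symm; omega
  subst hbd
  refine ⟨Nat.pow_right_injective (le_refl 2) ?_, rfl⟩
  simp only
  omega

def wo (n : ℕ) : Fin n → ℕ := fun s => 2 ^ s.1
def wτ (n : ℕ) : Fin n → ℕ := fun t => 2 ^ (n + 1) * 2 ^ t.1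

lemma wo_bound (n : ℕ) (s : Fin n) : wo n s + wo n s ≤ 2 ^ n := by
  have : 2 ^ (s.1 + 1) ≤ 2 ^ n := Nat.pow_le_pow_right (by norm_num) s.2
  rw [pow_succ] at this
  simp only [wo]; omega

lemma mod_split {M A A' B B' : ℕ} (hA : A < M) (hA' : A' < M) (h : A + M * B = A' + M * B') :
    A = A' ∧ B = B' := by
  have h1 := congrArg (· % M) h
  have h2 := congrArg (· / M) h
  have hM : 0 < M := by omega
  simp only [Nat.add_mul_mod_self_left, Nat.mod_eq_of_lt hA, Nat.mod_eq_of_lt hA'] at h1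
  simp only [Nat.add_mul_div_left _ _ hM, Nat.div_eq_of_lt hA, Nat.div_eq_of_lt hA'] at h2
  omega

lemma H_wo (n : ℕ) (s1 s2 t s1' s2' t' : Fin n) (h : s1 ≤ s2) (h' : s1' ≤ s2')
    (e : wo n s1 + wo n s2 + wτ n t = wo n s1' + wo n s2' + wτ n t') :
    s1 = s1' ∧ s2 = s2' ∧ t = t' := by
  have b1 := wo_bound n s1; have b2 := wo_bound n s2
  have b3 := wo_bound n s1'; have b4 := wo_bound n s2'
  have hp : 0 < 2 ^ n := by positivity
  have e' : 2 ^ (n+1) = 2 ^ n * 2 := pow_succ 2 n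
  obtain ⟨x1, x2⟩ := mod_split (M := 2 ^ (n+1)) (by omega) (by omega) e
  obtain ⟨y1, y2⟩ := pair_pow h h' x1
  exact ⟨Fin.ext y1, Fin.ext y2, Fin.ext (Nat.pow_right_injective (le_refl 2) x2)⟩

lemma H_wτ (n : ℕ) (s1 s2 t s1' s2' t' : Fin n) (h : s1 ≤ s2) (h' : s1' ≤ s2')
    (e : wτ n s1 + wτ n s2 + wo n t = wτ n s1' + wτ n s2' + wo n t') :
    s1 = s1' ∧ s2 = s2' ∧ t = t' := by
  have b1 := wo_bound n t; have b2 := wo_bound n t'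
  have hp : 0 < 2 ^ n := by positivity
  have e' : 2 ^ (n+1) = 2 ^ n * 2 := pow_succ 2 n
  have e2 : wo n t + 2 ^ (n+1) * (2 ^ s1.1 + 2 ^ s2.1) =
      wo n t' + 2 ^ (n+1) * (2 ^ s1'.1 + 2 ^ s2'.1) := by
    simp only [wτ] at e
    rw [mul_add, mul_add]; omega
  obtain ⟨x1, x2⟩ := mod_split (M := 2 ^ (n+1)) (by omega) (by omega) e2
  obtain ⟨y1, y2⟩ := pair_pow h h' x2
  exact ⟨Fin.ext y1, Fin.ext y2, Fin.ext (Nat.pow_right_injective (le_refl 2) x1)⟩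

lemma wtp_inj (n : ℕ) : Function.Injective (wtp (wo n) (wτ n)) := by
  rintro ⟨s, t⟩ ⟨s', t'⟩ h
  simp only [wtp] at h
  have b1 := wo_bound n s; have b2 := wo_bound n s'
  have hp : 0 < 2 ^ n := by positivity
  have e' : 2 ^ (n+1) = 2 ^ n * 2 := pow_succ 2 n
  obtain ⟨x1, x2⟩ := mod_split (M := 2 ^ (n+1)) (by omega) (by omega) h
  rw [Fin.ext (Nat.pow_right_injective (le_refl 2) x1),
    Fin.ext (Nat.pow_right_injective (le_refl 2) x2)]

end SecM2

section SecM4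
open Module Filter Topology

lemma exists_limit_euc {d r : ℕ} (E : ℕ → Submodule ℂ (EuclideanSpace ℂ (Fin d)))
    (hE : ∀ m, finrank ℂ (E m) = r) :
    ∃ φ : ℕ → ℕ, StrictMono φ ∧ ∃ F : Submodule ℂ (EuclideanSpace ℂ (Fin d)), finrank ℂ F = r ∧
      (∀ ψ : ℕ → ℕ, StrictMono ψ → ∀ (x : ℕ → EuclideanSpace ℂ (Fin d)) x0,
        (∀ m, x m ∈ E (φ (ψ m))) → Tendsto x atTop (𝓝 x0) → x0 ∈ F) ∧
      (∀ x ∈ F, ∃ y : ℕ → EuclideanSpace ℂ (Fin d), (∀ m, y m ∈ E (φ m)) ∧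
        Tendsto y atTop (𝓝 x)) := by
  have hb : ∀ m, ∃ o : Fin r → EuclideanSpace ℂ (Fin d), Orthonormal ℂ o ∧ (∀ i, o i ∈ E m) ∧
      ∀ x ∈ E m, ∑ i, inner ℂ (o i) x • o i = x := by
    intro m
    obtain ⟨b⟩ : Nonempty (OrthonormalBasis (Fin r) ℂ (E m)) :=
      ⟨(stdOrthonormalBasis ℂ (E m)).reindex (finCongr (hE m))⟩
    refine ⟨fun i => (b i : EuclideanSpace ℂ (Fin d)), ?_, fun i => (b i).2, fun x hx => ?_⟩
    · exact b.orthonormal.comp_linearIsometry (E m).subtypeₗᵢ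
    · have := congrArg Subtype.val (b.sum_repr' ⟨x, hx⟩)
      simpa using this
  choose o ho hoE hox using hb
  have hcomp : IsCompact (Set.univ.pi fun _ : Fin r =>
      Metric.closedBall (0 : EuclideanSpace ℂ (Fin d)) 1) :=
    isCompact_univ_pi fun _ => isCompact_closedBall _ _
  obtain ⟨p, -, φ, hφ, hlim⟩ := hcomp.tendsto_subseq (x := o) (fun m i _ => by
    simp [(ho m).norm_eq_one i])
  have hlim' : ∀ i, Tendsto (fun m => o (φ m) i) atTop (𝓝 (p i)) := fun i =>
    (tendsto_pi_nhds.1 hlim) i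
  have hp : Orthonormal ℂ p := by
    rw [orthonormal_iff_ite]
    intro i j
    have h1 : Tendsto (fun m => inner ℂ (o (φ m) i) (o (φ m) j)) atTop (𝓝 (inner ℂ (p i) (p j))) :=
      (hlim' i).inner (hlim' j)
    have h2 : ∀ m, inner ℂ (o (φ m) i) (o (φ m) j) = if i = j then (1:ℂ) else 0 := fun m =>
      (orthonormal_iff_ite.1 (ho (φ m))) i j
    simp_rw [h2] at h1
    exact tendsto_nhds_unique h1 tendsto_const_nhds |>.symm ▸ rfl
  refine ⟨φ, hφ, Submodule.span ℂ (Set.range p), ?_, ?_, ?_⟩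
  · rw [finrank_span_eq_card hp.linearIndependent]; simp
  · intro ψ hψ x x0 hx hlimx
    have h1 : Tendsto (fun m => ∑ i, inner ℂ (o (φ (ψ m)) i) (x m) • o (φ (ψ m)) i) atTop
        (𝓝 (∑ i, inner ℂ (p i) x0 • p i)) := by
      refine tendsto_finsetSum _ fun i _ => ?_
      have h2 := (hlim' i).comp hψ.tendsto_atTop
      exact (h2.inner hlimx).smul h2
    have h3 : ∀ m, ∑ i, inner ℂ (o (φ (ψ m)) i) (x m) • o (φ (ψ m)) i = x m := fun m =>
      hox _ _ (hx m)
    simp_rw [h3] at h1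
    rw [tendsto_nhds_unique hlimx h1]
    exact Submodule.sum_mem _ fun i _ => Submodule.smul_mem _ _ (Submodule.subset_span ⟨i, rfl⟩)
  · intro x hx
    obtain ⟨c, rfl⟩ := (Submodule.mem_span_range_iff_exists_fun ℂ).1 hx
    refine ⟨fun m => ∑ i, c i • o (φ m) i, fun m =>
      Submodule.sum_mem _ fun i _ => Submodule.smul_mem _ _ (hoE _ i), ?_⟩
    exact tendsto_finsetSum _ fun i _ => (hlim' i).const_smul _

lemma exists_limit {V : Type*} [NormedAddCommGroup V] [NormedSpace ℂ V] [FiniteDimensional ℂ V]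
    {r : ℕ} (E : ℕ → Submodule ℂ V) (hE : ∀ m, finrank ℂ (E m) = r) :
    ∃ φ : ℕ → ℕ, StrictMono φ ∧ ∃ F : Submodule ℂ V, finrank ℂ F = r ∧
      (∀ ψ : ℕ → ℕ, StrictMono ψ → ∀ (x : ℕ → V) x0,
        (∀ m, x m ∈ E (φ (ψ m))) → Tendsto x atTop (𝓝 x0) → x0 ∈ F) ∧
      (∀ x ∈ F, ∃ y : ℕ → V, (∀ m, y m ∈ E (φ m)) ∧ Tendsto y atTop (𝓝 x)) := by
  let e : V ≃L[ℂ] EuclideanSpace ℂ (Fin (finrank ℂ V)) :=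
    ContinuousLinearEquiv.ofFinrankEq (by simp)
  obtain ⟨φ, hφ, F, hF, h1, h2⟩ := exists_limit_euc (r := r)
    (fun m => (E m).map e.toLinearEquiv.toLinearMap)
    (fun m => by rw [LinearEquiv.finrank_map_eq]; exact hE m)
  refine ⟨φ, hφ, F.map e.symm.toLinearEquiv.toLinearMap, ?_, ?_, ?_⟩
  · rw [LinearEquiv.finrank_map_eq]; exact hF
  · intro ψ hψ x x0 hx hlim
    refine ⟨e x0, h1 ψ hψ (fun m => e (x m)) (e x0) (fun m => ⟨x m, hx m, rfl⟩)
      ((e.continuous.tendsto _).comp hlim), ?_⟩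
    exact e.symm_apply_apply x0
  · rintro _ ⟨z, hz, rfl⟩
    obtain ⟨y, hy, hlim⟩ := h2 z hz
    refine ⟨fun m => e.symm (y m), fun m => ?_, (e.symm.continuous.tendsto _).comp hlim⟩
    obtain ⟨x, hx, hxy⟩ := hy m
    change e.symm (y m) ∈ _
    rw [← hxy]
    change e.symm (e x) ∈ _
    rw [e.symm_apply_apply]; exact hx

/-- simple tensors -/
def stn {n : ℕ} (u : Fin 3 × Fin n → ℂ) (w : Fin n × Fin 3 → ℂ) : Fin n × Fin n → M3 :=
  fun p a k => u (a, p.1) * w (p.2, k)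

lemma span_stn (n : ℕ) : Submodule.span ℂ {x | ∃ u w, x = stn (n := n) u w} = ⊤ := by
  rw [eq_top_iff]
  intro x _
  have hx : x = ∑ p : Fin n × Fin n, ∑ a, ∑ k, x p a k •
      stn (Pi.single (a, p.1) 1) (Pi.single (p.2, k) 1) := by
    funext q a k
    obtain ⟨q1, q2⟩ := q
    simp only [Finset.sum_apply, Pi.smul_apply, stn, smul_eq_mul, Pi.single_apply, Prod.mk.injEq]
    rw [Finset.sum_eq_single (q1, q2), Finset.sum_eq_single a, Finset.sum_eq_single k]
    · simp
    · intro b _ hb; simp [hb.symm]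
    · simp
    · intro b _ hb; simp [hb.symm]
    · simp
    · rintro ⟨b1, b2⟩ _ hb
      refine Finset.sum_eq_zero fun i _ => Finset.sum_eq_zero fun j _ => ?_
      by_cases h1 : q1 = b1
      · have h2 : q2 ≠ b2 := fun h2 => hb (by rw [h1, h2])
        simp [h2]
      · simp [h1]
    · simp
  rw [hx]
  refine Submodule.sum_mem _ fun p _ => Submodule.sum_mem _ fun a _ => Submodule.sum_mem _
    fun k _ => Submodule.smul_mem _ _ (Submodule.subset_span ⟨_, _, rfl⟩)

lemma exists_K210 {n : ℕ} {ι : Type*} [Fintype ι] (u : ι → Fin 3 × Fin n → ℂ)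
    (w : ι → Fin n × Fin 3 → ℂ) (hli : LinearIndependent ℂ (fun i => stn (u i) (w i)))
    (E : Submodule ℂ (Fin n × Fin n → M3)) (hE : ∀ i, stn (u i) (w i) ∈ E) :
    ∃ K ≤ K210 E, finrank ℂ K = Fintype.card ι := by
  let θ : ι → (Fin n × Fin n × Fin n → T3) := fun i p a b k =>
    u i (a, p.1) * u i (b, p.2.1) * w i (p.2.2, k)
  have hθ : LinearIndependent ℂ θ := by
    rw [Fintype.linearIndependent_iff]
    intro c hc i
    have h1 : ∀ s b, ∀ j, c j * u j (b, s) = 0 := by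
      intro s b
      apply (Fintype.linearIndependent_iff.1 hli)
      funext p a k
      have := congrFun (congrFun (congrFun (congrFun hc (p.1, s, p.2)) a) b) k
      simp only [Finset.sum_apply, Pi.smul_apply, smul_eq_mul, θ, Pi.zero_apply] at this
      simp only [Finset.sum_apply, Pi.smul_apply, smul_eq_mul, stn, Pi.zero_apply]
      rw [← this]
      refine Finset.sum_congr rfl fun j _ => by ring
    by_contra hci
    apply hli.ne_zero i
    funext p a k
    have := (mul_eq_zero.1 (h1 p.1 a i)).resolve_left hci
    simp [stn, this]
  refine ⟨Submodule.span ℂ (Set.range θ), ?_, finrank_span_eq_card hθ⟩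
  rw [Submodule.span_le]
  rintro _ ⟨i, rfl⟩
  refine ⟨fun s1 s2 t a b k => by simp only [θ]; ring, fun s2 b => ?_⟩
  convert E.smul_mem (u i (b, s2)) (hE i) using 1
  funext p a k
  simp only [θ, stn, Pi.smul_apply, smul_eq_mul]; ring

def tGL (n : ℕ) : (Fin n × Fin n → M3) ≃ₗ[ℂ] (Fin n × Fin n → M3) where
  toFun e := fun p a k => e (p.2, p.1) k a
  invFun e := fun p a k => e (p.2, p.1) k a
  map_add' _ _ := rfl
  map_smul' _ _ := rfl
  left_inv _ := rfl
  right_inv _ := rfl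

lemma exists_E {n r : ℕ} (hr : r ≤ 9 * n ^ 2) (u : Fin r → Fin 3 × Fin n → ℂ)
    (w : Fin r → Fin n × Fin 3 → ℂ) :
    ∃ E : Submodule ℂ (Fin n × Fin n → M3), finrank ℂ E = r ∧ (∀ l, stn (u l) (w l) ∈ E) ∧
      (∃ K ≤ K210 E, finrank ℂ K = r) ∧ (∃ K ≤ K210 (tG E), finrank ℂ K = r) := by
  obtain ⟨b0, hb0, hspan0, hli0⟩ := exists_linearIndependent ℂ
    (Set.range fun l => stn (u l) (w l))
  rw [linearIndependent_subtype_iff] at hli0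
  obtain ⟨b, hb, hb0b, hspan, hli⟩ := exists_linearIndepOn_id_extension hli0
    (t := {x | ∃ u w, x = stn (n := n) u w}) (hb0.trans (by rintro _ ⟨l, rfl⟩; exact ⟨_, _, rfl⟩))
  have hbfin : b.Finite := hli.linearIndependent.setFinite
  have htop : Submodule.span ℂ b = ⊤ := by
    rw [eq_top_iff, ← span_stn, Submodule.span_le]; exact hspan
  have hcard : b.ncard = 9 * n ^ 2 := by
    have : Fintype b := hbfin.fintype
    have h := finrank_span_set_eq_card (R := ℂ) (s := b) hli
    rw [htop, finrank_top, Module.finrank_pi_fintype] at h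
    rw [Set.ncard_eq_toFinset_card', ← h]
    have h9 : finrank ℂ M3 = 9 := by
      rw [Module.finrank_pi_fintype]; simp
    simp [h9]; ring
  have hb0card : b0.ncard ≤ r := by
    refine (Set.ncard_le_ncard hb0 (Set.finite_range _)).trans ?_
    rw [← Set.image_univ]
    refine (Set.ncard_image_le).trans ?_
    simp
  obtain ⟨c, hbc, hcb, hc⟩ := Set.exists_subsuperset_card_eq hb0b hb0card (hcard ▸ hr)
  have hcfin := hbfin.subset hcb
  have : Fintype c := hcfin.fintype
  have hcc : Fintype.card c = r := by rw [← hc, Set.ncard_eq_toFinset_card', Set.toFinset_card]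
  have hlic : LinearIndependent ℂ (fun x : c => (x : Fin n × Fin n → M3)) :=
    (hli.mono hcb).linearIndependent
  choose u' w' huw using fun x : c => hb (hcb x.2)
  have hlic' : LinearIndependent ℂ (fun x : c => stn (u' x) (w' x)) := by
    simp_rw [← huw]; exact hlic
  refine ⟨Submodule.span ℂ c, ?_, fun l => ?_, ?_, ?_⟩
  · have := finrank_span_eq_card hlic
    rw [Subtype.range_coe] at this
    rw [this, hcc]
  · have : stn (u l) (w l) ∈ Submodule.span ℂ b0 := by
      rw [hspan0]; exact Submodule.subset_span ⟨l, rfl⟩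
    exact Submodule.span_mono hbc this
  · rw [← hcc]
    exact exists_K210 u' w' hlic' _ (fun i => by rw [← huw]; exact Submodule.subset_span i.2)
  · rw [← hcc]
    refine exists_K210 (fun i p => w' i (p.2, p.1)) (fun i p => u' i (p.2, p.1)) ?_ _ (fun i => ?_)
    · have := hlic'.map' (tGL n).toLinearMap (LinearEquiv.ker _)
      have hfun : (fun i => stn (fun p => w' i (p.2,p.1)) (fun p => u' i (p.2,p.1))) =
          ⇑(tGL n).toLinearMap ∘ fun x => stn (u' x) (w' x) := by
        funext i p a k
        simp [tGL, stn, mul_comm]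
      rw [hfun]; exact this
    · have : stn (u' i) (w' i) ∈ Submodule.span ℂ c := by
        rw [← huw]; exact Submodule.subset_span i.2
      change (fun (p : Fin n × Fin n) a k => _) ∈ Submodule.span ℂ c
      convert this using 1
      funext p a k
      simp [stn, mul_comm]

end SecM4

section SecM5
open Module Filter Topology

lemma tendsto_fun4 {n : ℕ} {x : ℕ → (Fin n × Fin n → M3)} {x0 : Fin n × Fin n → M3}
    (h : ∀ p a k, Tendsto (fun m => x m p a k) atTop (𝓝 (x0 p a k))) :
    Tendsto x atTop (𝓝 x0) := by
  rw [tendsto_pi_nhds]; intro p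
  rw [tendsto_pi_nhds]; intro a
  rw [tendsto_pi_nhds]; intro k
  exact h p a k

lemma lim_K {n r : ℕ} {E : ℕ → Submodule ℂ (Fin n × Fin n → M3)}
    {F : Submodule ℂ (Fin n × Fin n → M3)}
    (hlim : ∀ ψ : ℕ → ℕ, StrictMono ψ → ∀ (x : ℕ → (Fin n × Fin n → M3)) x0,
        (∀ m, x m ∈ E (ψ m)) → Tendsto x atTop (𝓝 x0) → x0 ∈ F)
    (K : ℕ → Submodule ℂ (Fin n × Fin n × Fin n → T3)) (hK : ∀ m, K m ≤ K210 (E m))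
    (hr : ∀ m, finrank ℂ (K m) = r) : r ≤ finrank ℂ (K210 F) := by
  obtain ⟨φ, hφ, L, hL, -, h2⟩ := exists_limit K hr
  rw [← hL]
  refine Submodule.finrank_mono fun θ hθ => ?_
  obtain ⟨y, hy, hyl⟩ := h2 θ hθ
  have hc : ∀ p a b k, Tendsto (fun m => y m p a b k) atTop (𝓝 (θ p a b k)) := by
    intro p a b k
    exact tendsto_pi_nhds.1 (tendsto_pi_nhds.1 (tendsto_pi_nhds.1 (tendsto_pi_nhds.1 hyl p) a) b) k
  have hyK : ∀ m, y m ∈ K210 (E (φ m)) := fun m => hK _ (hy m)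
  refine ⟨fun s1 s2 t a b k => ?_, fun s2 b => ?_⟩
  · have h1 := hc (s1,s2,t) a b k
    have h3 : (fun m => y m (s1,s2,t) a b k) = fun m => y m (s2,s1,t) b a k := by
      funext m; exact (hyK m).1 s1 s2 t a b k
    rw [h3] at h1
    exact tendsto_nhds_unique h1 (hc (s2,s1,t) b a k)
  · refine hlim φ hφ (fun m p a k => y m (p.1,s2,p.2) a b k) _ (fun m => (hyK m).2 s2 b) ?_
    exact tendsto_fun4 fun p a k => hc _ _ _ _

lemma main_limit {n r : ℕ} (hr : r ≤ 9 * n ^ 2)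
    (hT : matMulTensor 3 n n ∈ closure {S | rankLE S r}) :
    ∃ E : Submodule ℂ (Fin n × Fin n → M3), finrank ℂ E = r ∧
      (∀ s t, (fun p => if p = (s,t) then idM else 0) ∈ E) ∧
      r ≤ finrank ℂ (K210 E) ∧ r ≤ finrank ℂ (K210 (tG E)) := by
  rw [mem_closure_iff_seq_limit] at hT
  obtain ⟨S, hS, hSl⟩ := hT
  choose u v w hS using hS
  choose E hE hEs hX hY using fun m => exists_E hr (u m) (w m)
  choose K hK hKr using hX
  choose K' hK' hKr' using hY
  obtain ⟨φ, hφ, F, hF, h1, -⟩ := exists_limit E hE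
  have hcomp : ∀ i j k, Tendsto (fun m => S m i j k) atTop (𝓝 (matMulTensor 3 n n i j k)) := by
    intro i j k
    exact tendsto_pi_nhds.1 (tendsto_pi_nhds.1 (tendsto_pi_nhds.1 hSl i) j) k
  refine ⟨F, hF, fun s t => ?_, ?_, ?_⟩
  · refine h1 id strictMono_id (fun m p a k => S (φ m) (a,p.1) (s,t) (p.2,k)) _ (fun m => ?_) ?_
    · have : (fun (p : Fin n × Fin n) (a : Fin 3) (k : Fin 3) => S (φ m) (a,p.1) (s,t) (p.2,k)) =
          ∑ l, v (φ m) l (s,t) • stn (u (φ m) l) (w (φ m) l) := by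
        funext p a k
        rw [hS (φ m)]
        simp only [Finset.sum_apply, Pi.smul_apply, stn, smul_eq_mul]
        exact Finset.sum_congr rfl fun l _ => by ring
      rw [this]
      exact Submodule.sum_mem _ fun l _ => Submodule.smul_mem _ _ (hEs _ l)
    · refine tendsto_fun4 fun p a k => ?_
      have h := (hcomp (a,p.1) (s,t) (p.2,k)).comp hφ.tendsto_atTop
      have hval : (if p = (s, t) then idM else 0) a k =
          matMulTensor 3 n n (a, p.1) (s, t) (p.2, k) := by
        obtain ⟨p1, p2⟩ := p
        simp only [matMulTensor, Prod.mk.injEq]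
        by_cases h1 : p1 = s
        · by_cases h2 : p2 = t
          · subst h1 h2; simp [idM, eq_comm]
          · have h2' : ¬ t = p2 := fun h => h2 h.symm
            simp [h2, h2']
        · simp [h1]
      rw [hval]; exact h
  · exact lim_K (E := fun m => E (φ m)) h1 (fun m => K (φ m)) (fun m => hK _) (fun m => hKr _)
  · refine lim_K (E := fun m => tG (E (φ m))) ?_ (fun m => K' (φ m)) (fun m => hK' _)
      (fun m => hKr' _)
    intro ψ hψ x x0 hx hl
    refine h1 ψ hψ (fun m p a k => x m (p.2,p.1) k a) _ hx (tendsto_fun4 fun p a k => ?_)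
    exact tendsto_pi_nhds.1 (tendsto_pi_nhds.1 (tendsto_pi_nhds.1 hl (p.2,p.1)) k) a

lemma rankLE_mono {ι κ μ : Type} {T : ι → κ → μ → ℂ} {r r' : ℕ} (h : r ≤ r')
    (hT : rankLE T r) : rankLE T r' := by
  obtain ⟨d, rfl⟩ := Nat.exists_eq_add_of_le h
  obtain ⟨u, v, w, rfl⟩ := hT
  refine ⟨Fin.append u 0, Fin.append v 0, Fin.append w 0, ?_⟩
  funext i j k
  rw [Fin.sum_univ_add]
  simp

lemma rankLE_matMul (n : ℕ) : ∃ r, rankLE (matMulTensor 3 n n) r := by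
  let e := (Fintype.equivFin (Fin 3 × Fin n × Fin n)).symm
  refine ⟨Fintype.card (Fin 3 × Fin n × Fin n),
    fun l i => if i = ((e l).1, (e l).2.1) then 1 else 0,
    fun l j => if j = ((e l).2.1, (e l).2.2) then 1 else 0,
    fun l k => if k = ((e l).2.2, (e l).1) then 1 else 0, ?_⟩
  funext i j k
  rw [Equiv.sum_comp e (fun q => (if i = (q.1, q.2.1) then (1:ℂ) else 0) *
    (if j = (q.2.1, q.2.2) then 1 else 0) * (if k = (q.2.2, q.1) then 1 else 0))]
  obtain ⟨i1, i2⟩ := i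
  obtain ⟨j1, j2⟩ := j
  obtain ⟨k1, k2⟩ := k
  rw [Finset.sum_eq_single (i1, i2, k1)]
  · simp only [matMulTensor, Prod.mk.injEq]
    by_cases h1 : i2 = j1 <;> by_cases h2 : j2 = k1 <;> by_cases h3 : k2 = i1 <;>
      simp [h1, h2, h3, eq_comm]
  · rintro ⟨a, b, c⟩ _ hne
    simp only [Prod.mk.injEq]
    by_cases h1 : i1 = a
    · by_cases h2 : i2 = b
      · have : k1 ≠ c := fun h => hne (by rw [h1, h2, h])
        simp [this]
      · simp [h2]
    · simp [h1]
  · simp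

lemma brank_lt {n R : ℕ} (h : brank (matMulTensor 3 n n) < R) :
    matMulTensor 3 n n ∈ closure {S | rankLE S (R - 1)} := by
  have hne : {r | matMulTensor 3 n n ∈ closure {S | rankLE S r}}.Nonempty := by
    obtain ⟨r, hr⟩ := rankLE_matMul n
    exact ⟨r, subset_closure hr⟩
  have h1 := Nat.sInf_mem hne
  refine closure_mono ?_ h1
  intro S hS
  exact rankLE_mono (by unfold brank at h; omega) hS

end SecM5

section SecM3


/-- sum over ordered pairs in the same column -/
def Qc {n : ℕ} (g : Fin n → Fin n → ℝ) : ℝ :=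
  ∑ t, ∑ s1, ∑ s2, if s1 = s2 then 0 else g s1 t * g s2 t

lemma Qc_eq {n : ℕ} (g : Fin n → Fin n → ℝ) :
    Qc g = ∑ t, ((∑ s, g s t) ^ 2 - ∑ s, g s t ^ 2) := by
  refine Finset.sum_congr rfl fun t _ => ?_
  have h : ∀ s1 s2, (if s1 = s2 then 0 else g s1 t * g s2 t) =
      g s1 t * g s2 t - if s1 = s2 then g s1 t * g s2 t else 0 := by
    intro s1 s2; split_ifs <;> simp
  simp_rw [h, Finset.sum_sub_distrib]
  congr 1
  · rw [sq, Finset.sum_mul_sum]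
  · refine Finset.sum_congr rfl fun s _ => ?_
    simp [sq]

lemma Qc_nonneg {n : ℕ} (g : Fin n → Fin n → ℝ) (hg : ∀ s t, 0 ≤ g s t) : 0 ≤ Qc g := by
  refine Finset.sum_nonneg fun t _ => Finset.sum_nonneg fun s _ => Finset.sum_nonneg fun s' _ => ?_
  split_ifs
  · exact le_refl _
  · exact mul_nonneg (hg _ _) (hg _ _)

lemma Qc_le {n : ℕ} (g : Fin n → Fin n → ℝ) (hg : ∀ s t, 0 ≤ g s t) (R : Fin n) (u : ℝ)
    (hu : ∀ t, ∑ s, g s t ≤ u) :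
    Qc g ≤ u * (∑ t, ∑ s, g s t - ∑ t, g R t) + ∑ t, ∑ s, g s t * (g R t - g s t) := by
  rw [Qc_eq, ← Finset.sum_sub_distrib, Finset.mul_sum, ← Finset.sum_add_distrib]
  refine Finset.sum_le_sum fun t _ => ?_
  have h1 : ∑ s, g s t * (g R t - g s t) = (∑ s, g s t) * g R t - ∑ s, g s t ^ 2 := by
    rw [Finset.sum_mul, ← Finset.sum_sub_distrib]
    exact Finset.sum_congr rfl fun s _ => by ring
  rw [h1]
  have h2 : g R t ≤ ∑ s, g s t :=
    Finset.single_le_sum (f := fun s => g s t) (fun s _ => hg s t) (Finset.mem_univ R)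
  nlinarith [mul_nonneg (sub_nonneg.2 (hu t)) (sub_nonneg.2 h2)]

lemma sqrt_UV {u v G : ℝ} (hu : 0 ≤ u) (hv : 0 ≤ v) (huG : u ≤ G) (hvG : v ≤ G) :
    √(u * (G - v)) + √(v * (G - u)) ≤ G := by
  have h1 : √(u * (G - v)) ≤ (u + (G - v)) / 2 := by
    rw [Real.sqrt_le_left (by linarith)]
    nlinarith [sq_nonneg (u - (G - v))]
  have h2 : √(v * (G - u)) ≤ (v + (G - u)) / 2 := by
    rw [Real.sqrt_le_left (by linarith)]
    nlinarith [sq_nonneg (v - (G - u))]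
  linarith

lemma sum_ge_col {n : ℕ} (g : Fin n → Fin n → ℝ) (hg : ∀ s t, 0 ≤ g s t) (t : Fin n) :
    ∑ s, g s t ≤ ∑ t, ∑ s, g s t :=
  Finset.single_le_sum (f := fun t => ∑ s, g s t)
    (fun t _ => Finset.sum_nonneg fun s _ => hg s t) (Finset.mem_univ t)

/-- indicator estimate -/
lemma rook_ind {n : ℕ} (hn : 0 < n) (g : Fin n → Fin n → ℝ) (hg : ∀ s t, g s t = 0 ∨ g s t = 1) :
    √(Qc g) + √(Qc fun t s => g s t) ≤ ∑ t, ∑ s, g s t := by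
  have : Nonempty (Fin n) := ⟨⟨0, hn⟩⟩
  have hg0 : ∀ s t, 0 ≤ g s t := by
    intro s t; rcases hg s t with h | h <;> rw [h]; norm_num
  have hg1 : ∀ s t, g s t ≤ 1 := by
    intro s t; rcases hg s t with h | h <;> rw [h]; norm_num
  have hneg : ∀ s t x, x ≤ 1 → g s t * (x - g s t) ≤ 0 := by
    intro s t x hx; rcases hg s t with h | h <;> rw [h]
    · simp
    · linarith
  obtain ⟨t0, ht0⟩ := Finite.exists_max fun t => ∑ s, g s t
  obtain ⟨s0, hs0⟩ := Finite.exists_max fun s => ∑ t, g s t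
  have h1 := Qc_le g hg0 s0 _ ht0
  have h2 := Qc_le (fun t s => g s t) (fun t s => hg0 s t) t0 _ hs0
  have e1 : ∑ t, ∑ s, g s t * (g s0 t - g s t) ≤ 0 :=
    Finset.sum_nonpos fun t _ => Finset.sum_nonpos fun s _ => hneg s t _ (hg1 _ _)
  have e2 : ∑ s, ∑ t, g s t * (g s t0 - g s t) ≤ 0 :=
    Finset.sum_nonpos fun t _ => Finset.sum_nonpos fun s _ => hneg t s _ (hg1 _ _)
  have e3 : ∑ s, ∑ t, g s t = ∑ t, ∑ s, g s t := Finset.sum_comm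
  have hu := sum_ge_col g hg0 t0
  have hv := sum_ge_col (fun t s => g s t) (fun t s => hg0 s t) s0
  beta_reduce at h1 h2 hv
  rw [e3] at h2 hv
  refine le_trans (add_le_add (Real.sqrt_le_sqrt (h1.trans ?_)) (Real.sqrt_le_sqrt (h2.trans ?_)))
    (sqrt_UV (Finset.sum_nonneg fun s _ => hg0 s t0) (Finset.sum_nonneg fun t _ => hg0 s0 t) hu hv)
  · linarith
  · linarith

noncomputable def phr (x : ℕ) : ℝ := if x = 0 then 0 else if x = 1 then 1 / 2 else 1
def ind (j x : ℕ) : ℝ := if j ≤ x then 1 else 0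
noncomputable def hb (x y : ℕ) : ℝ := 3 * (2 * (phr x * phr y) + ∑ j ∈ Finset.Icc 3 8, ind j x * ind j y)
def one (x : ℕ) : ℝ := if x = 1 then 1 else 0

lemma phr_nonneg (x : ℕ) : 0 ≤ phr x := by unfold phr; split_ifs <;> norm_num
lemma ind_nonneg (j x : ℕ) : 0 ≤ ind j x := by unfold ind; split_ifs <;> norm_num
lemma ind_cases (j x : ℕ) : ind j x = 0 ∨ ind j x = 1 := by unfold ind; split_ifs <;> simp
lemma ind_le_phr {j : ℕ} (hj : 3 ≤ j) (x : ℕ) : ind j x ≤ phr x := by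
  unfold ind phr; split_ifs <;> first | omega | norm_num
lemma phr_one (x y : ℕ) : phr x * (phr y - phr x) ≤ one x / 4 := by
  unfold phr one; split_ifs <;> norm_num
lemma phr_sum {x : ℕ} (hx : x ≤ 8) : 2 * phr x + ∑ j ∈ Finset.Icc 3 8, ind j x = x := by
  have h : Finset.Icc 3 8 = {3,4,5,6,7,8} := by decide
  have h2 : ∀ F : ℕ → ℝ, ∑ j ∈ Finset.Icc 3 8, F j =
      F 3 + (F 4 + (F 5 + (F 6 + (F 7 + F 8)))) := by
    intro F; rw [h]; simp
  rw [h2]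
  interval_cases x <;> norm_num [phr, ind]

/-- the `φ` estimate for one direction together with the bounds on the indicators. -/
lemma rook_phr {n : ℕ} (f : Fin n → Fin n → ℕ) (u : ℝ) (R : Fin n)
    (hu : ∀ t, ∑ s, phr (f s t) ≤ u) :
    Qc (fun s t => phr (f s t)) ≤ u * (∑ t, ∑ s, phr (f s t) - ∑ t, phr (f R t)) +
      (∑ t, ∑ s, one (f s t)) / 4 ∧
    ∀ j, 3 ≤ j → Qc (fun s t => ind j (f s t)) ≤
      u * (∑ t, ∑ s, phr (f s t) - ∑ t, phr (f R t)) := by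
  constructor
  · refine (Qc_le _ (fun s t => phr_nonneg _) R u hu).trans ?_
    refine add_le_add (le_refl _) ?_
    rw [Finset.sum_div]
    refine Finset.sum_le_sum fun t _ => ?_
    rw [Finset.sum_div]
    exact Finset.sum_le_sum fun s _ => phr_one _ _
  · intro j hj
    have hu' : ∀ t, ∑ s, ind j (f s t) ≤ u := fun t =>
      (Finset.sum_le_sum fun s _ => ind_le_phr hj _).trans (hu t)
    have hu0 : ∀ t : Fin n, 0 ≤ u := fun t => (Finset.sum_nonneg fun s _ => phr_nonneg _).trans (hu t)
    refine (Qc_le _ (fun s t => ind_nonneg _ _) R u hu').trans ?_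
    have e1 : ∑ t, ∑ s, ind j (f s t) * (ind j (f R t) - ind j (f s t)) ≤ 0 := by
      refine Finset.sum_nonpos fun t _ => Finset.sum_nonpos fun s _ => ?_
      rcases ind_cases j (f s t) with h | h <;> rcases ind_cases j (f R t) with h' | h' <;>
        rw [h, h'] <;> norm_num
    have e2 : ∑ t, ∑ s, ind j (f s t) - ∑ t, ind j (f R t) ≤
        ∑ t, ∑ s, phr (f s t) - ∑ t, phr (f R t) := by
      rw [← Finset.sum_sub_distrib, ← Finset.sum_sub_distrib]
      refine Finset.sum_le_sum fun t _ => ?_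
      have := Finset.single_le_sum (f := fun s => phr (f s t) - ind j (f s t))
        (fun s _ => sub_nonneg.2 (ind_le_phr hj _)) (Finset.mem_univ R)
      rw [Finset.sum_sub_distrib] at this
      linarith
    have := mul_le_mul_of_nonneg_left e2 (hu0 R)
    linarith

lemma Qc_hb {n : ℕ} (f : Fin n → Fin n → ℕ) :
    (∑ t, ∑ s1, ∑ s2, if s1 = s2 then 0 else hb (f s1 t) (f s2 t)) =
    3 * (2 * Qc (fun s t => phr (f s t)) +
      ∑ j ∈ Finset.Icc 3 8, Qc (fun s t => ind j (f s t))) := by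
  have h1 : ∑ j ∈ Finset.Icc 3 8, Qc (fun s t => ind j (f s t)) =
      ∑ t, ∑ s1, ∑ s2, ∑ j ∈ Finset.Icc 3 8,
        if s1 = s2 then 0 else ind j (f s1 t) * ind j (f s2 t) := by
    unfold Qc
    rw [Finset.sum_comm]
    refine Finset.sum_congr rfl fun t _ => ?_
    rw [Finset.sum_comm]
    refine Finset.sum_congr rfl fun s _ => ?_
    rw [Finset.sum_comm]
  rw [h1]
  unfold Qc
  simp only [Finset.mul_sum, ← Finset.sum_add_distrib]
  refine Finset.sum_congr rfl fun t _ => Finset.sum_congr rfl fun s1 _ =>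
    Finset.sum_congr rfl fun s2 _ => ?_
  split_ifs
  · simp
  · simp [hb, Finset.mul_sum]

lemma fin_arith {x z A B N P d Q1 Q2 : ℝ} (hx : 0 ≤ x) (hz : 0 ≤ z) (hA0 : 0 ≤ A) (hB0 : 0 ≤ B)
    (k1 : Q1 ≤ x * A + d / 2) (k2 : Q2 ≤ z * B + d / 2) (hABN : A + B ≤ N) (hUV : x + z ≤ P)
    (hd : 0 ≤ d) : ∃ l m : ℝ, 0 ≤ l ∧ 0 ≤ m ∧ l + m = 1 ∧
      l * (3 * Q1) + m * (3 * Q2) ≤ 3 * (l * m) * N * P + 3 / 2 * d := by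
  have hN0 : 0 ≤ N := by linarith
  by_cases h0 : A + B = 0
  · have hA' : A = 0 := by linarith
    have hB' : B = 0 := by linarith
    refine ⟨1/2, 1/2, by norm_num, by norm_num, by norm_num, ?_⟩
    rw [hA'] at k1; rw [hB'] at k2
    have hP0 : 0 ≤ P := by linarith
    have := mul_nonneg hN0 hP0
    linarith
  · have hpos : 0 < A + B := lt_of_le_of_ne (by linarith) (Ne.symm h0)
    obtain ⟨l, hl⟩ : ∃ l, l = B / (A + B) := ⟨_, rfl⟩
    obtain ⟨m, hm⟩ : ∃ m, m = A / (A + B) := ⟨_, rfl⟩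
    have hl0 : 0 ≤ l := by rw [hl]; positivity
    have hm0 : 0 ≤ m := by rw [hm]; positivity
    have hlm : l + m = 1 := by rw [hl, hm, ← add_div, add_comm B A, div_self h0]
    have hAm : A = m * (A + B) := by rw [hm]; field_simp
    have hBl : B = l * (A + B) := by rw [hl]; field_simp
    refine ⟨l, m, hl0, hm0, hlm, ?_⟩
    have g1 := mul_le_mul_of_nonneg_left k1 hl0
    have g2 := mul_le_mul_of_nonneg_left k2 hm0
    have g3 : l * (x * A) + m * (z * B) = (l * m) * ((A + B) * (x + z)) := by
      calc l * (x * A) + m * (z * B) = l * (x * (m * (A + B))) + m * (z * (l * (A+B))) := by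
            rw [← hAm, ← hBl]
        _ = _ := by ring
    have g4 : (A + B) * (x + z) ≤ N * P :=
      mul_le_mul hABN hUV (by linarith) hN0
    have g5 := mul_le_mul_of_nonneg_left g4 (mul_nonneg hl0 hm0)
    have g6 : l * (d / 2) + m * (d / 2) = d / 2 := by rw [← add_mul, hlm, one_mul]
    calc l * (3 * Q1) + m * (3 * Q2) = 3 * (l * Q1 + m * Q2) := by ring
      _ ≤ 3 * (l * (x * A + d / 2) + m * (z * B + d / 2)) := by linarith
      _ = 3 * ((l * (x * A) + m * (z * B)) + (l * (d / 2) + m * (d / 2))) := by ring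
      _ ≤ 3 * (l * m * (N * P) + d / 2) := by rw [g3, g6]; linarith
      _ = _ := by ring

lemma lemB {n : ℕ} (hn : 0 < n) (f : Fin n → Fin n → ℕ) (hf : ∀ s t, f s t ≤ 8) (N : ℝ)
    (hN : ∑ t, ∑ s, (f s t : ℝ) ≤ N) :
    ∃ l m : ℝ, 0 ≤ l ∧ 0 ≤ m ∧ l + m = 1 ∧
      l * (∑ t, ∑ s1, ∑ s2, if s1 = s2 then 0 else hb (f s1 t) (f s2 t)) +
      m * (∑ s, ∑ t1, ∑ t2, if t1 = t2 then 0 else hb (f s t1) (f s t2)) ≤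
      3 * (l * m) * N * (∑ t, ∑ s, phr (f s t)) + 3 / 2 * (∑ t, ∑ s, one (f s t)) := by
  have : Nonempty (Fin n) := ⟨⟨0, hn⟩⟩
  obtain ⟨t0, ht0⟩ := Finite.exists_max fun t => ∑ s, phr (f s t)
  obtain ⟨s0, hs0⟩ := Finite.exists_max fun s => ∑ t, phr (f s t)
  obtain ⟨h1, h1j⟩ := rook_phr f _ s0 ht0
  obtain ⟨h2, h2j⟩ := rook_phr (fun t s => f s t) _ t0 hs0
  rw [Qc_hb f, Qc_hb (fun t s => f s t)]
  have e3 : ∑ s, ∑ t, phr (f s t) = ∑ t, ∑ s, phr (f s t) := Finset.sum_comm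
  have e4 : ∑ s, ∑ t, one (f s t) = ∑ t, ∑ s, one (f s t) := Finset.sum_comm
  have hu := sum_ge_col (fun s t => phr (f s t)) (fun s t => phr_nonneg _) t0
  have hv := sum_ge_col (fun t s => phr (f s t)) (fun t s => phr_nonneg _) s0
  have hu0 : 0 ≤ ∑ s, phr (f s t0) := Finset.sum_nonneg fun s _ => phr_nonneg _
  have hv0 : 0 ≤ ∑ t, phr (f s0 t) := Finset.sum_nonneg fun s _ => phr_nonneg _
  beta_reduce at h2 h2j hu hv
  rw [e3, e4] at h2
  rw [e3] at h2j hv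
  have hj := fun j => rook_ind hn (fun s t => ind j (f s t)) (fun s t => ind_cases _ _)
  have hd : 0 ≤ ∑ t, ∑ s, one (f s t) := Finset.sum_nonneg fun t _ =>
    Finset.sum_nonneg fun s _ => by unfold one; split_ifs <;> norm_num
  have hsum : 2 * (∑ t, ∑ s, phr (f s t)) + ∑ j ∈ Finset.Icc 3 8, ∑ t, ∑ s, ind j (f s t) =
      ∑ t, ∑ s, (f s t : ℝ) := by
    rw [Finset.sum_comm (s := Finset.Icc 3 8), Finset.mul_sum, ← Finset.sum_add_distrib]
    refine Finset.sum_congr rfl fun t _ => ?_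
    rw [Finset.sum_comm (s := Finset.Icc 3 8), Finset.mul_sum, ← Finset.sum_add_distrib]
    exact Finset.sum_congr rfl fun s _ => phr_sum (hf s t)
  have hUV := sqrt_UV hu0 hv0 hu hv
  have hU0 := mul_nonneg hu0 (sub_nonneg.2 hv)
  have hV0 := mul_nonneg hv0 (sub_nonneg.2 hu)
  set U := (∑ s, phr (f s t0)) * (∑ t, ∑ s, phr (f s t) - ∑ t, phr (f s0 t)) with hU
  set V := (∑ t, phr (f s0 t)) * (∑ t, ∑ s, phr (f s t) - ∑ s, phr (f s t0)) with hV
  set P := ∑ t, ∑ s, phr (f s t) with hP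
  set d := ∑ t, ∑ s, one (f s t) with hdd
  set q1 := fun j => Qc (fun s t => ind j (f s t)) with hq1
  set q2 := fun j => Qc (fun t s => ind j (f s t)) with hq2
  have hb1 : ∑ j ∈ Finset.Icc 3 8, q1 j ≤ √U * ∑ j ∈ Finset.Icc 3 8, √(q1 j) := by
    rw [Finset.mul_sum]
    refine Finset.sum_le_sum fun j hj' => ?_
    have h0 : 0 ≤ q1 j := Qc_nonneg _ fun _ _ => ind_nonneg _ _
    calc q1 j = √(q1 j) * √(q1 j) := (Real.mul_self_sqrt h0).symm
      _ ≤ _ := mul_le_mul_of_nonneg_right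
        (Real.sqrt_le_sqrt (h1j j (Finset.mem_Icc.1 hj').1)) (Real.sqrt_nonneg _)
  have hb2 : ∑ j ∈ Finset.Icc 3 8, q2 j ≤ √V * ∑ j ∈ Finset.Icc 3 8, √(q2 j) := by
    rw [Finset.mul_sum]
    refine Finset.sum_le_sum fun j hj' => ?_
    have h0 : 0 ≤ q2 j := Qc_nonneg _ fun _ _ => ind_nonneg _ _
    calc q2 j = √(q2 j) * √(q2 j) := (Real.mul_self_sqrt h0).symm
      _ ≤ _ := mul_le_mul_of_nonneg_right
        (Real.sqrt_le_sqrt (h2j j (Finset.mem_Icc.1 hj').1)) (Real.sqrt_nonneg _)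
  have hab : ∑ j ∈ Finset.Icc 3 8, √(q1 j) + ∑ j ∈ Finset.Icc 3 8, √(q2 j) ≤
      ∑ j ∈ Finset.Icc 3 8, ∑ t, ∑ s, ind j (f s t) := by
    rw [← Finset.sum_add_distrib]
    exact Finset.sum_le_sum fun j _ => hj j
  have hx0 : 0 ≤ ∑ j ∈ Finset.Icc 3 8, √(q1 j) := Finset.sum_nonneg fun j _ => Real.sqrt_nonneg _
  have hy0 : 0 ≤ ∑ j ∈ Finset.Icc 3 8, √(q2 j) := Finset.sum_nonneg fun j _ => Real.sqrt_nonneg _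
  have hUs := Real.mul_self_sqrt hU0
  have hVs := Real.mul_self_sqrt hV0
  have hx := Real.sqrt_nonneg U
  have hz := Real.sqrt_nonneg V
  set x := √U
  set z := √V
  set X := ∑ j ∈ Finset.Icc 3 8, √(q1 j)
  set Z := ∑ j ∈ Finset.Icc 3 8, √(q2 j)
  have k1 : 2 * Qc (fun s t => phr (f s t)) + ∑ j ∈ Finset.Icc 3 8, q1 j ≤
      x * (2 * x + X) + d / 2 := by nlinarith
  have k2 : 2 * Qc (fun t s => phr (f s t)) + ∑ j ∈ Finset.Icc 3 8, q2 j ≤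
      z * (2 * z + Z) + d / 2 := by nlinarith
  have hABN : (2 * x + X) + (2 * z + Z) ≤ N := by linarith
  have hA0 : 0 ≤ 2 * x + X := by linarith
  have hB0 : 0 ≤ 2 * z + Z := by linarith
  exact fin_arith hx hz hA0 hB0 k1 k2 hABN hUV hd

end SecM3

section SecM6


/-- cost bound of a cell -/
noncomputable def cst (p : ℝ) : ℕ → ℝ
  | 0 => 0
  | 1 => 7 / 4 + 3 / 16 * (2 * p + 1)
  | 2 => 4 + 3 / 8 * (2 * p + 1)
  | 3 => 7 + (4 / 3 * p + 67 / 200)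
  | 4 => 9 + (4 / 3 * p + 67 / 200)
  | 5 => 12 + p + 3 / 8 * (2 * p + 1)
  | 6 => 14 + p + (4 / 3 * p + 67 / 200)
  | 7 => 17 + 2 * p + 3 / 8 * (2 * p + 1)
  | _ => 18 + 3 * p + 3 / 8 * (2 * p + 1)

def sg : ℕ → ℕ
  | 0 => 0
  | 1 => 1
  | 2 => 4
  | 3 => 7
  | 4 => 9
  | 5 => 12
  | 6 => 14
  | 7 => 17
  | _ => 18

lemma quad_bd {l m p : ℝ} (hp : 14 ≤ p) (hlm : l + m = 1) :
    p * l + 3 / 2 * (l * m) * (2 * p + 1) ≤ 4 / 3 * p + 67 / 200 := by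
  have hm : m = 1 - l := by linarith
  subst hm
  have h1 : 0 ≤ (p - 14) * (l - 2 / 3) ^ 2 := mul_nonneg (by linarith) (sq_nonneg _)
  nlinarith [sq_nonneg (l - 2 / 3 + 1 / 174)]

lemma cost_le {f a b σ1 σ2 : ℕ} {l m p : ℝ} (hp : 14 ≤ p) (hl : 0 ≤ l) (hm : 0 ≤ m)
    (hlm : l + m = 1) (hf : f ≤ 8) (ha : 3 * a ≤ f ∨ (a = 3 ∧ f = 8))
    (hb : 3 * b ≤ f ∨ (b = 3 ∧ f = 8)) (h1 : 1 ≤ a → 1 ≤ b → 5 ≤ f) (h2 : 2 ≤ a → 2 ≤ b → 7 ≤ f)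
    (hσ1 : σ1 ≤ sg f) (hσ2 : σ2 ≤ sg f) :
    l * σ1 + m * σ2 + p * (l * a + m * b) + 3 / 2 * (l * m) * (2 * p + 1) * phr f
      + 3 / 4 * one f ≤ cst p f := by
  have s1 : l * σ1 + m * σ2 ≤ sg f := by
    have e1 : (σ1 : ℝ) ≤ sg f := by exact_mod_cast hσ1
    have e2 : (σ2 : ℝ) ≤ sg f := by exact_mod_cast hσ2
    calc l * σ1 + m * σ2 ≤ l * sg f + m * sg f :=
          add_le_add (mul_le_mul_of_nonneg_left e1 hl) (mul_le_mul_of_nonneg_left e2 hm)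
      _ = sg f := by rw [← add_mul, hlm, one_mul]
  have q1 := quad_bd hp hlm
  have q2 := quad_bd (l := m) (m := l) hp (by linarith)
  have q3 : 3 / 2 * (l * m) * (2 * p + 1) ≤ 3 / 8 * (2 * p + 1) := by
    refine mul_le_mul_of_nonneg_right ?_ (by linarith)
    have hm' : m = 1 - l := by linarith
    subst hm'
    nlinarith [sq_nonneg (l - 1 / 2)]
  have hpl : 0 ≤ p * l := mul_nonneg (by linarith) hl
  have hpm : 0 ≤ p * m := mul_nonneg (by linarith) hm
  have hpp : p * l + p * m = p := by rw [← mul_add, hlm, mul_one]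
  rw [mul_comm m l] at q2
  set Z := 3 / 2 * (l * m) * (2 * p + 1) with hZ
  have ha3 : a ≤ 3 := by omega
  have hb3 : b ≤ 3 := by omega
  have key : ∀ x : ℝ, l * σ1 + m * σ2 + p * (l * a + m * b) + x ≤
      sg f + ((a : ℝ) * (p * l) + (b : ℝ) * (p * m)) + x := by
    intro x
    have : p * (l * a + m * b) = (a : ℝ) * (p * l) + (b : ℝ) * (p * m) := by ring
    linarith
  rw [add_assoc]
  refine (key _).trans ?_
  interval_cases f <;> interval_cases a <;> first
    | omega
    | (interval_cases b <;> first
        | omega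
        | (simp only [sg, cst, phr, one]; norm_num; linarith)
        | (simp only [sg, cst, phr, one]; norm_num))

lemma superadd {ι : Type*} (S : Finset ι) (B : ℕ → ℕ) (N : ℕ)
    (hB : ∀ a b, a + b ≤ N → B a + B b ≤ B (a + b)) (x : ι → ℕ) (hS : ∑ i ∈ S, x i ≤ N) :
    ∑ i ∈ S, B (x i) ≤ B (∑ i ∈ S, x i) := by
  classical
  induction S using Finset.induction_on with
  | empty => simp
  | insert i S hi ih =>
    rw [Finset.sum_insert hi] at hS ⊢
    rw [Finset.sum_insert hi]
    exact (Nat.add_le_add_left (ih (by omega)) _).trans (hB _ _ hS)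

lemma sum_cst_table {n R : ℕ} {p : ℝ} (B : ℕ → ℕ) (N : ℕ)
    (hB : ∀ a < N + 1, ∀ b < N + 1, a + b ≤ N → B a + B b ≤ B (a + b))
    (f : Fin n → Fin n → ℕ)
    (hs : ∑ t, ∑ s, f s t ≤ N) (hc : ∀ s t, 16 * cst p (f s t) ≤ B (f s t))
    (hR : ∀ a < N + 1, B a < 16 * R) : ∑ t, ∑ s, cst p (f s t) < R := by
  have e1 : ∑ t, ∑ s, f s t = ∑ c : Fin n × Fin n, f c.2 c.1 :=
    (Fintype.sum_prod_type' (fun t s => f s t)).symm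
  have e2 : ∑ t, ∑ s, cst p (f s t) = ∑ c : Fin n × Fin n, cst p (f c.2 c.1) :=
    (Fintype.sum_prod_type' (fun t s => cst p (f s t))).symm
  rw [e1] at hs
  rw [e2]
  have h1 := superadd Finset.univ B N (fun a b h => hB a (by omega) b (by omega) h)
    (fun c : Fin n × Fin n => f c.2 c.1) hs
  have h2 := hR _ (by omega : (∑ c : Fin n × Fin n, f c.2 c.1) < N + 1)
  have h3 : ∑ c : Fin n × Fin n, 16 * cst p (f c.2 c.1) ≤ ∑ c : Fin n × Fin n, (B (f c.2 c.1) : ℝ) :=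
    Finset.sum_le_sum fun c _ => hc _ _
  rw [← Finset.mul_sum] at h3
  have h4 : (∑ c : Fin n × Fin n, (B (f c.2 c.1) : ℝ)) < 16 * R := by
    exact_mod_cast lt_of_le_of_lt h1 h2
  linarith

def tb15 : ℕ → ℕ := fun m => [0, 115, 238, 417, 532, 655, 834, 949, 1134, 1251, 1372, 1551, 1668, 1789, 1968, 2085, 2268, 2385, 2506, 2685, 2802, 2923, 3102, 3219, 3402, 3519, 3640, 3819, 3936, 4057].getD m 0
def tb16 : ℕ → ℕ := fun m => [0, 121, 250, 438, 559, 688, 876, 997, 1194, 1315, 1444, 1632, 1753, 1882, 2070, 2191, 2388, 2509, 2638, 2826, 2947, 3076, 3264, 3385, 3582, 3703, 3832, 4020, 4141, 4270, 4458, 4579].getD m 0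
def tb17 : ℕ → ℕ := fun m => [0, 127, 262, 459, 586, 721, 918, 1045, 1254, 1381, 1516, 1713, 1840, 1975, 2172, 2299, 2508, 2635, 2770, 2967, 3094, 3229, 3426, 3553, 3762, 3889, 4024, 4221, 4348, 4483, 4680, 4807, 5016, 5143].getD m 0
def tb18 : ℕ → ℕ := fun m => [0, 133, 274, 481, 614, 755, 962, 1095, 1314, 1447, 1588, 1795, 1928, 2069, 2276, 2409, 2628, 2761, 2902, 3109, 3242, 3383, 3590, 3723, 3942, 4075, 4216, 4423, 4556, 4697, 4904, 5037, 5256, 5389, 5530, 5737].getD m 0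


lemma sum_cst15 (f : Fin 15 → Fin 15 → ℕ) (hf : ∀ s t, f s t ≤ 8)
    (hs : ∑ t, ∑ s, f s t ≤ 29) : ∑ t, ∑ s, cst 14 (f s t) < 254 := by
  refine sum_cst_table (R := 254) tb15 29 (by decide) f hs ?_ (by decide)
  intro s t
  have := hf s t
  interval_cases f s t <;> norm_num [cst, tb15]

lemma sum_cst16 (f : Fin 16 → Fin 16 → ℕ) (hf : ∀ s t, f s t ≤ 8)
    (hs : ∑ t, ∑ s, f s t ≤ 31) : ∑ t, ∑ s, cst 15 (f s t) < 287 := by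
  refine sum_cst_table (R := 287) tb16 31 (by decide) f hs ?_ (by decide)
  intro s t
  have := hf s t
  interval_cases f s t <;> norm_num [cst, tb16]

lemma sum_cst17 (f : Fin 17 → Fin 17 → ℕ) (hf : ∀ s t, f s t ≤ 8)
    (hs : ∑ t, ∑ s, f s t ≤ 33) : ∑ t, ∑ s, cst 16 (f s t) < 322 := by
  refine sum_cst_table (R := 322) tb17 33 (by decide) f hs ?_ (by decide)
  intro s t
  have := hf s t
  interval_cases f s t <;> norm_num [cst, tb17]

lemma sum_cst18 (f : Fin 18 → Fin 18 → ℕ) (hf : ∀ s t, f s t ≤ 8)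
    (hs : ∑ t, ∑ s, f s t ≤ 35) : ∑ t, ∑ s, cst 17 (f s t) < 359 := by
  refine sum_cst_table (R := 359) tb18 35 (by decide) f hs ?_ (by decide)
  intro s t
  have := hf s t
  interval_cases f s t <;> norm_num [cst, tb18]

lemma sum_cst_big {n : ℕ} (hn : 19 ≤ n) (f : Fin n → Fin n → ℕ) (hf : ∀ s t, f s t ≤ 8)
    (hs : ∑ t, ∑ s, f s t + 1 ≤ 2 * n) :
    ∑ t, ∑ s, cst ((n : ℝ) - 1) (f s t) < (n : ℝ) ^ 2 + 2 * n - 1 := by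
  obtain ⟨p, hp⟩ : ∃ p : ℝ, p = (n : ℝ) - 1 := ⟨_, rfl⟩
  have hn' : (19 : ℝ) ≤ n := by exact_mod_cast hn
  have hp18 : 18 ≤ p := by linarith
  have hs' : ∑ t, ∑ s, (f s t : ℝ) ≤ 2 * p + 1 := by
    have : ((∑ t, ∑ s, f s t : ℕ) : ℝ) + 1 ≤ 2 * n := by exact_mod_cast hs
    push_cast at this; linarith
  have hcell : ∀ s t, (2 * p + 1) * cst p (f s t) ≤ (p ^ 2 + 4 * p + 3 / 2) * (f s t : ℝ) := by
    intro s t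
    have := hf s t
    interval_cases f s t <;> simp only [cst] <;> push_cast <;> nlinarith
  have h1 : (2 * p + 1) * ∑ t, ∑ s, cst p (f s t) ≤
      (p ^ 2 + 4 * p + 3 / 2) * ∑ t, ∑ s, (f s t : ℝ) := by
    simp only [Finset.mul_sum]
    exact Finset.sum_le_sum fun t _ => Finset.sum_le_sum fun s _ => hcell s t
  have h2 : (2 * p + 1) * ∑ t, ∑ s, cst p (f s t) ≤ (2 * p + 1) * (p ^ 2 + 4 * p + 3 / 2) := by
    refine h1.trans ?_
    rw [mul_comm (2 * p + 1)]
    exact mul_le_mul_of_nonneg_left hs' (by positivity)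
  have h3 := le_of_mul_le_mul_left h2 (by linarith)
  rw [← hp]
  have : (n : ℝ) = p + 1 := by linarith
  rw [this]; nlinarith

lemma sum_cst {n : ℕ} (hn : 14 < n) (f : Fin n → Fin n → ℕ) (hf : ∀ s t, f s t ≤ 8)
    (hs : ∑ t, ∑ s, f s t + 1 ≤ 2 * n) :
    ∑ t, ∑ s, cst ((n : ℝ) - 1) (f s t) < (n : ℝ) ^ 2 + 2 * n - 1 := by
  by_cases h : 19 ≤ n
  · exact sum_cst_big h f hf hs
  · have h4 : n = 15 ∨ n = 16 ∨ n = 17 ∨ n = 18 := by omega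
    rcases h4 with rfl | rfl | rfl | rfl
    · have := sum_cst15 f hf (by omega); norm_num at this ⊢; exact this
    · have := sum_cst16 f hf (by omega); norm_num at this ⊢; exact this
    · have := sum_cst17 f hf (by omega); norm_num at this ⊢; exact this
    · have := sum_cst18 f hf (by omega); norm_num at this ⊢; exact this

lemma pair_sum {n : ℕ} (a : Fin n → ℝ) :
    (∑ s1, ∑ s2, if s1 = s2 then 0 else a s1 + a s2) = 2 * ((n : ℝ) - 1) * ∑ s, a s := by
  have h : ∀ s1 s2, (if s1 = s2 then 0 else a s1 + a s2) =
      a s1 + a s2 - if s1 = s2 then a s1 + a s2 else 0 := by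
    intro s1 s2; split_ifs <;> simp
  simp_rw [h, Finset.sum_sub_distrib, Finset.sum_add_distrib]
  simp [← Finset.mul_sum]
  rw [Finset.sum_add_distrib]
  ring

lemma side_bound {n r : ℕ} (f α σ : Fin n → Fin n → ℕ) (W : Fin n → Fin n → Fin n → ℕ)
    (hW : ∀ s1 s2 t, s1 ≠ s2 → (W s1 s2 t : ℝ) ≤ α s1 t + α s2 t + hb (f s1 t) (f s2 t))
    (K : 2 * r ≤ ∑ t, (2 * ∑ s, σ s t + ∑ s1, ∑ s2, if s1 = s2 then 0 else W s1 s2 t)) :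
    2 * (r : ℝ) ≤ 2 * ∑ t, ∑ s, (σ s t : ℝ) + 2 * ((n : ℝ) - 1) * ∑ t, ∑ s, (α s t : ℝ) +
      ∑ t, ∑ s1, ∑ s2, if s1 = s2 then 0 else hb (f s1 t) (f s2 t) := by
  have K' : 2 * (r : ℝ) ≤ ∑ t, (2 * ∑ s, (σ s t : ℝ) +
      ∑ s1, ∑ s2, if s1 = s2 then 0 else (W s1 s2 t : ℝ)) := by
    exact_mod_cast K
  refine K'.trans ?_
  rw [Finset.mul_sum, Finset.mul_sum, ← Finset.sum_add_distrib, ← Finset.sum_add_distrib]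
  refine Finset.sum_le_sum fun t _ => ?_
  rw [add_assoc]
  refine add_le_add (le_refl _) ?_
  rw [← pair_sum fun s => (α s t : ℝ), ← Finset.sum_add_distrib]
  refine Finset.sum_le_sum fun s1 _ => ?_
  rw [← Finset.sum_add_distrib]
  refine Finset.sum_le_sum fun s2 _ => ?_
  split_ifs with h
  · simp
  · exact hW _ _ _ h

theorem comb {n r : ℕ} (hn : 14 < n) (f α β σ1 σ2 : Fin n → Fin n → ℕ) (hf : ∀ s t, f s t ≤ 8)
    (hs : ∑ t, ∑ s, f s t + 1 ≤ 2 * n)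
    (ha : ∀ s t, 3 * α s t ≤ f s t ∨ (α s t = 3 ∧ f s t = 8))
    (hbe : ∀ s t, 3 * β s t ≤ f s t ∨ (β s t = 3 ∧ f s t = 8))
    (h1 : ∀ s t, 1 ≤ α s t → 1 ≤ β s t → 5 ≤ f s t)
    (h2 : ∀ s t, 2 ≤ α s t → 2 ≤ β s t → 7 ≤ f s t)
    (hσ1 : ∀ s t, σ1 s t ≤ sg (f s t)) (hσ2 : ∀ s t, σ2 s t ≤ sg (f s t))
    (W1 W2 : Fin n → Fin n → Fin n → ℕ)
    (hW1 : ∀ s1 s2 t, s1 ≠ s2 → (W1 s1 s2 t : ℝ) ≤ α s1 t + α s2 t + hb (f s1 t) (f s2 t))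
    (hW2 : ∀ t1 t2 s, t1 ≠ t2 → (W2 t1 t2 s : ℝ) ≤ β s t1 + β s t2 + hb (f s t1) (f s t2))
    (hr : r + 1 = n ^ 2 + 2 * n)
    (K1 : 2 * r ≤ ∑ t, (2 * ∑ s, σ1 s t + ∑ s1, ∑ s2, if s1 = s2 then 0 else W1 s1 s2 t))
    (K2 : 2 * r ≤ ∑ s, (2 * ∑ t, σ2 s t + ∑ t1, ∑ t2, if t1 = t2 then 0 else W2 t1 t2 s)) :
    False := by
  have k1 := side_bound f α σ1 W1 hW1 K1
  have k2 := side_bound (fun t s => f s t) (fun t s => β s t) (fun t s => σ2 s t) W2 hW2 K2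
  beta_reduce at k2
  have c1 : ∑ s, ∑ t, (σ2 s t : ℝ) = ∑ t, ∑ s, (σ2 s t : ℝ) := Finset.sum_comm
  have c2 : ∑ s, ∑ t, (β s t : ℝ) = ∑ t, ∑ s, (β s t : ℝ) := Finset.sum_comm
  rw [c1, c2] at k2
  have hs' : ∑ t, ∑ s, (f s t : ℝ) ≤ 2 * ((n : ℝ) - 1) + 1 := by
    have : ((∑ t, ∑ s, f s t : ℕ) : ℝ) + 1 ≤ 2 * n := by exact_mod_cast hs
    push_cast at this; linarith
  obtain ⟨l, m, hl, hm, hlm, hB⟩ := lemB (by omega) f hf _ hs'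
  have hp : (14 : ℝ) ≤ (n : ℝ) - 1 := by
    have : ((15 : ℕ) : ℝ) ≤ n := by exact_mod_cast hn
    push_cast at this; linarith
  have hfin := sum_cst hn f hf hs
  have hr' : (r : ℝ) = (n : ℝ) ^ 2 + 2 * n - 1 := by
    have : (r : ℝ) + 1 = (n : ℝ) ^ 2 + 2 * n := by exact_mod_cast hr
    linarith
  rw [← hr'] at hfin
  set p := (n : ℝ) - 1
  have hcost : ∑ t, ∑ s, (l * σ1 s t + m * σ2 s t + p * (l * α s t + m * β s t) +
      3 / 2 * (l * m) * (2 * p + 1) * phr (f s t) + 3 / 4 * one (f s t)) ≤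
      ∑ t, ∑ s, cst p (f s t) :=
    Finset.sum_le_sum fun t _ => Finset.sum_le_sum fun s _ =>
      cost_le hp hl hm hlm (hf s t) (ha s t) (hbe s t) (h1 s t) (h2 s t) (hσ1 s t) (hσ2 s t)
  simp only [Finset.sum_add_distrib, ← Finset.mul_sum] at hcost
  have g1 := mul_le_mul_of_nonneg_left k1 hl
  have g2 := mul_le_mul_of_nonneg_left k2 hm
  have g3 : l * (2 * (r : ℝ)) + m * (2 * r) = 2 * r := by rw [← add_mul, hlm, one_mul]
  linarith

end SecM6

section SecM7
open Module

lemma SS_le_sg (E : Submodule ℂ M3) (hE : idM ∈ E) :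
    finrank ℂ (SS E) ≤ sg (finrank ℂ E - 1) := by
  have h9 := finrank_M3_le E
  have h1 := finrank_pos_of_id hE
  have hW := Submodule.finrank_mono (SS_le_WW E)
  by_cases h : finrank ℂ E = 1
  · have := finrank_WW_le E E hE
    obtain ⟨a1, a2, a3⟩ := alpha_le E hE
    rw [h]; simp only [Nat.sub_self, sg]; omega
  by_cases h' : finrank ℂ E = 2
  · have := finrank_WW_one E E hE hE h'
    rw [h']; simp only [Nat.add_one_sub_one, sg]; omega
  obtain ⟨p, q, x1, x2, x3, x4, x5⟩ := finrank_SS_le E hE (by omega)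
  generalize finrank ℂ E = d at *
  have : 3 ≤ d := by omega
  interval_cases d <;> simp only [sg, Nat.reduceSub] <;> omega

lemma hb_min {x y : ℕ} (hx : x ≤ 8) (hy : y ≤ 8) (h : ¬ (x = 1 ∧ y = 1)) :
    3 * ((min x y : ℕ) : ℝ) ≤ hb x y := by
  have h1 : Finset.Icc 3 8 = {3,4,5,6,7,8} := by decide
  have h2 : ∀ F : ℕ → ℝ, ∑ j ∈ Finset.Icc 3 8, F j =
      F 3 + (F 4 + (F 5 + (F 6 + (F 7 + F 8)))) := by
    intro F; rw [h1]; simp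
  unfold hb
  rw [h2]
  interval_cases x <;> interval_cases y <;> first
    | omega
    | norm_num [phr, ind]

lemma WW_le_hb (E F : Submodule ℂ M3) (hE : idM ∈ E) (hF : idM ∈ F) :
    (finrank ℂ (WW E F) : ℝ) ≤ finrank ℂ (Av E) + finrank ℂ (Av F) +
      hb (finrank ℂ E - 1) (finrank ℂ F - 1) := by
  have hE1 := finrank_pos_of_id hE
  have hF1 := finrank_pos_of_id hF
  have hE9 := finrank_M3_le E
  have hF9 := finrank_M3_le F
  by_cases h : finrank ℂ E - 1 = 1 ∧ finrank ℂ F - 1 = 1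
  · have h1 := finrank_WW_one E F hE hF (by omega)
    have h2 : finrank ℂ (WW E F) ≤ 1 := by omega
    have h3 : (finrank ℂ (WW E F) : ℝ) ≤ 1 := by exact_mod_cast h2
    rw [h.1, h.2]
    have h4 : (1 : ℝ) ≤ hb 1 1 := by
      have : 0 ≤ ∑ j ∈ Finset.Icc 3 8, ind j 1 * ind j 1 :=
        Finset.sum_nonneg fun j _ => mul_nonneg (ind_nonneg _ _) (ind_nonneg _ _)
      have e : phr 1 = 1 / 2 := by norm_num [phr]
      unfold hb; rw [e]; linarith
    have h5 : (0 : ℝ) ≤ finrank ℂ (Av E) := Nat.cast_nonneg _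
    have h6 : (0 : ℝ) ≤ finrank ℂ (Av F) := Nat.cast_nonneg _
    linarith
  · have h0 := hb_min (by omega) (by omega) h
    have h1 := finrank_WW_le E F hE
    have h2 := finrank_WW_le F E hF
    rw [finrank_WW_comm F E] at h2
    have h3 : finrank ℂ (WW E F) ≤ finrank ℂ (Av E) + finrank ℂ (Av F) +
        3 * min (finrank ℂ E - 1) (finrank ℂ F - 1) := by omega
    have h4 : (finrank ℂ (WW E F) : ℝ) ≤ finrank ℂ (Av E) + finrank ℂ (Av F) +
        3 * ((min (finrank ℂ E - 1) (finrank ℂ F - 1) : ℕ) : ℝ) := by exact_mod_cast h3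
    linarith

theorem borderRank_aux (n : ℕ) (hn : 14 < n) :
    n ^ 2 + 2 * n ≤ brank (matMulTensor 3 n n) := by
  by_contra hcon
  have hT := brank_lt (not_le.1 hcon)
  obtain ⟨r, hr⟩ : ∃ r, r = n ^ 2 + 2 * n - 1 := ⟨_, rfl⟩
  rw [← hr] at hT
  have hn2 : 14 * n ≤ n ^ 2 := by rw [sq]; exact Nat.mul_le_mul_right n hn.le
  obtain ⟨E, hE, hid, hK1, hK2⟩ := main_limit (by omega) hT
  let C : Fin n → Fin n → Submodule ℂ M3 := fun s t => inn (wtp (wo n) (wτ n)) E (s,t)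
  have hC : ∀ s t, idM ∈ C s t := by
    intro s t
    refine ⟨_, hid s t, by simp, fun j hj => ?_⟩
    have : j ≠ (s,t) := fun h => by rw [h] at hj; exact lt_irrefl _ hj
    simp [this]
  have hC' : ∀ s t, idM ∈ trE (C s t) := fun s t => idM_mem_trE (hC s t)
  have hsum := finrank_eq_sum_inn _ (wtp_inj n) E
  have hs : ∑ t, ∑ s, (finrank ℂ (C s t) - 1) + 1 ≤ 2 * n := by
    have e1 : ∑ t, ∑ s, finrank ℂ (C s t) = r := by
      have e0 := Fintype.sum_prod_type
        (fun c : Fin n × Fin n => finrank ℂ (inn (wtp (wo n) (wτ n)) E c))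
      rw [← hE, hsum, e0, Finset.sum_comm]
    have e2 : ∑ t, ∑ s, finrank ℂ (C s t) = ∑ t, ∑ s, (finrank ℂ (C s t) - 1) + n ^ 2 := by
      have : ∀ s t, finrank ℂ (C s t) = (finrank ℂ (C s t) - 1) + 1 := fun s t => by
        have := finrank_pos_of_id (hC s t); omega
      calc ∑ t, ∑ s, finrank ℂ (C s t) = ∑ t, ∑ s, ((finrank ℂ (C s t) - 1) + 1) :=
            Finset.sum_congr rfl fun t _ => Finset.sum_congr rfl fun s _ => this s t
        _ = _ := by simp [Finset.sum_add_distrib, sq]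
    omega
  have k1 := finrank_K210_le E (wo n) (wτ n) (H_wo n)
  have k2 := finrank_K210_le (tG E) (wτ n) (wo n) (H_wτ n)
  have e : ∀ s t, inn (wtp (wτ n) (wo n)) (tG E) (t,s) = trE (C s t) := fun s t => inn_tG _ _ _ _ _
  refine comb (r := r) hn (fun s t => finrank ℂ (C s t) - 1) (fun s t => finrank ℂ (Av (C s t)))
    (fun s t => finrank ℂ (Av (trE (C s t)))) (fun s t => finrank ℂ (SS (C s t)))
    (fun s t => finrank ℂ (SS (trE (C s t)))) ?_ hs ?_ ?_ ?_ ?_ ?_ ?_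
    (fun s1 s2 t => finrank ℂ (WW (C s1 t) (C s2 t)))
    (fun t1 t2 s => finrank ℂ (WW (trE (C s t1)) (trE (C s t2)))) ?_ ?_ (by omega) ?_ ?_
  · intro s t; have := finrank_M3_le (C s t); omega
  · intro s t
    have h1 := alpha_le (C s t) (hC s t)
    have h2 := finrank_M3_le (C s t)
    omega
  · intro s t
    have h1 := alpha_le _ (hC' s t)
    rw [finrank_trE] at h1
    have h2 := finrank_M3_le (C s t)
    omega
  · intro s t ha hb
    obtain ⟨h1, h2⟩ := alpha_beta (C s t) (hC s t)
    have h3 := (alpha_le (C s t) (hC s t)).1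
    have h4 := (alpha_le _ (hC' s t)).1
    beta_reduce at ha hb ⊢
    generalize finrank ℂ (Av (C s t)) = x at *
    generalize finrank ℂ (Av (trE (C s t))) = y at *
    interval_cases x <;> interval_cases y <;> omega
  · intro s t ha hb
    obtain ⟨h1, h2⟩ := alpha_beta (C s t) (hC s t)
    have h3 := (alpha_le (C s t) (hC s t)).1
    have h4 := (alpha_le _ (hC' s t)).1
    beta_reduce at ha hb ⊢
    generalize finrank ℂ (Av (C s t)) = x at *
    generalize finrank ℂ (Av (trE (C s t))) = y at *
    interval_cases x <;> interval_cases y <;> omega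
  · intro s t; exact SS_le_sg _ (hC s t)
  · intro s t
    have := SS_le_sg _ (hC' s t)
    rw [finrank_trE] at this
    exact this
  · intro s1 s2 t _; exact WW_le_hb _ _ (hC _ _) (hC _ _)
  · intro t1 t2 s _
    have := WW_le_hb _ _ (hC' s t1) (hC' s t2)
    rw [finrank_trE, finrank_trE] at this
    exact this
  · exact (Nat.mul_le_mul_left 2 hK1).trans k1
  · refine (Nat.mul_le_mul_left 2 hK2).trans (k2.trans (le_of_eq ?_))
    refine Finset.sum_congr rfl fun s _ => ?_
    congr 1
    · congr 1
      refine Finset.sum_congr rfl fun t _ => ?_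
      rw [e]
    · refine Finset.sum_congr rfl fun t1 _ => Finset.sum_congr rfl fun t2 _ => ?_
      rw [e, e]

end SecM7

/-- for `n > 14`, `BR(M⟨3,n,n⟩) ≥ n² + 2n`. -/
theorem borderRank_matMul_3nn (n : ℕ) (hn : 14 < n) :
    n ^ 2 + 2 * n ≤ brank (matMulTensor 3 n n) := by
  exact borderRank_aux n hn

end
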